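/- arXiv:2311.08008 — 3 statements merged into one kernel-verified Lean document; each statement's English description precedes it below -/
import Mathlib

section
/- Let Q• →^{σ•} P• →^{τ•} F• be morphisms of complexes of R-modules with Q_j = P_j = F_j = 0 for j < 0, with differentials d_Q^i: Q_i → Q_{i−1}, d_P^i, d_F^i. Assume all three complexes are acyclic (exact in every degree j ≠ 0), that the sequence 0 → coker d_Q^1 → coker d_P^1 →^{α} coker d_F^1 is exact, and that there exists a degree-one map ℓ•: Q• → F•[1] satisfying d_F^{i+1} ℓ_i + ℓ_{i−1} d_Q^i = τ_i σ_i for every integer i. Then the complex with terms Q_i ⊕ P_{i+1} ⊕ F_{i+2} and differential given in block-matrix form by rows (d_Q^i, 0, 0), (σ_i, −d_P^{i+1}, 0), (ℓ_i, −τ_{i+1}, d_F^{i+2}) is exact in every degree i ≠ −2, and the cokernel of its differential d^{−1} equals coker α. -/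
/-!
Common setup for formalizing "Schur powers of the cokernel of a graded morphism"
by J.O. Kleppe and R.M. Miró-Roig.
-/

open Matrix TensorProduct CategoryTheory

noncomputable section

namespace KMR

/-- The standard graded polynomial ring `R = k[x₀,…,xₙ]`. -/
abbrev RR (k : Type) [Field k] (n : ℕ) : Type := MvPolynomial (Fin (n + 1)) k

variable {k : Type} [Field k] {n : ℕ}

/-- The irrelevant maximal ideal `𝔪 = (x₀,…,xₙ)`. -/
def mxI (k : Type) [Field k] (n : ℕ) : Ideal (RR k n) :=
  Ideal.span (Set.range MvPolynomial.X)

/-- The ideal `I_j(A)` generated by the `j × j` minors of the matrix `A`. -/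
def minors {g t : ℕ} (A : Matrix (Fin g) (Fin t) (RR k n)) (j : ℕ) : Ideal (RR k n) :=
  Ideal.span {m | ∃ (r : Fin j → Fin g) (c : Fin j → Fin t),
    Function.Injective r ∧ Function.Injective c ∧ m = (A.submatrix r c).det}

/-- The matrix `A` represents a graded morphism `φ : F = ⊕ R(bⱼ) → G = ⊕ R(aᵢ)`,
i.e. each entry `A i j` is homogeneous of degree `aᵢ - bⱼ` (or zero). -/
def IsHomogMatrix {g t : ℕ} (A : Matrix (Fin g) (Fin t) (RR k n))
    (a : Fin g → ℤ) (b : Fin t → ℤ) : Prop :=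
  ∀ i j, A i j = 0 ∨ ∃ d : ℕ, (d : ℤ) = a i - b j ∧ (A i j).IsHomogeneous d

/-- The morphism `φ` is minimal, i.e. `φ(F) ⊆ 𝔪 G`:
all entries of a representing matrix have vanishing constant term. -/
def IsMinMatrix {g t : ℕ} (A : Matrix (Fin g) (Fin t) (RR k n)) : Prop :=
  ∀ i j, MvPolynomial.constantCoeff (A i j) = 0

/-- `depthGE J N d` : there is an `N`-regular sequence of length `d` inside `J`,
i.e. `depth_J N ≥ d`. -/
def depthGE {R : Type} [CommRing R] (J : Ideal R) (N : Type) [AddCommGroup N] [Module R N]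
    (d : ℕ) : Prop :=
  ∃ rs : List R, rs.length = d ∧ (∀ x ∈ rs, x ∈ J) ∧ RingTheory.Sequence.IsRegular N rs

/-- `depthEQ J N d` : the length of a maximal `N`-regular sequence in `J` is exactly `d`. -/
def depthEQ {R : Type} [CommRing R] (J : Ideal R) (N : Type) [AddCommGroup N] [Module R N]
    (d : ℕ) : Prop :=
  depthGE J N d ∧ ¬ depthGE J N (d + 1)

/-- The morphism `φ : F → G` of free modules represented by the matrix `A`. -/
def phi {g t : ℕ} (A : Matrix (Fin g) (Fin t) (RR k n)) :
    (Fin t → RR k n) →ₗ[RR k n] (Fin g → RR k n) := A.mulVecLin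

/-- The dual morphism `φ* : G* → F*`, represented by the transposed matrix. -/
def phiStar {g t : ℕ} (A : Matrix (Fin g) (Fin t) (RR k n)) :
    (Fin g → RR k n) →ₗ[RR k n] (Fin t → RR k n) := A.transpose.mulVecLin

/-- `M = coker (φ*)`. -/
abbrev Mdl {g t : ℕ} (A : Matrix (Fin g) (Fin t) (RR k n)) : Type :=
  (Fin t → RR k n) ⧸ LinearMap.range (phiStar A)

/-- The canonical projection `F* → M = coker φ*`. -/
def MdlProj {g t : ℕ} (A : Matrix (Fin g) (Fin t) (RR k n)) :
    (Fin t → RR k n) →ₗ[RR k n] Mdl A :=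
  Submodule.mkQ _

/-- The `i`-th symmetric power of a module, as a quotient of the `i`-th tensor power. -/
abbrev SymPow (R : Type) [CommRing R] (M : Type) [AddCommGroup M] [Module R M] (i : ℕ) : Type :=
  (⨂[R]^i M) ⧸ Submodule.span R
    {z | ∃ (σ : Equiv.Perm (Fin i)) (f : Fin i → M),
      z = PiTensorProduct.tprod R f - PiTensorProduct.tprod R (f ∘ σ)}

section ExtPow

variable {R M N : Type} [CommRing R] [AddCommGroup M] [Module R M]
  [AddCommGroup N] [Module R N]

lemma extPow_map_mem (p : ℕ) (f : M →ₗ[R] N) {x : ExteriorAlgebra R M}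
    (hx : x ∈ ⋀[R]^p M) : ExteriorAlgebra.map f x ∈ ⋀[R]^p N := by
  rw [← ExteriorAlgebra.ιMulti_span_fixedDegree] at hx ⊢
  induction hx using Submodule.span_induction with
  | mem x h =>
      obtain ⟨v, rfl⟩ := h
      rw [ExteriorAlgebra.map_apply_ιMulti]
      exact Submodule.subset_span ⟨_, rfl⟩
  | zero => simpa using Submodule.zero_mem _
  | add x y _ _ h1 h2 => simpa using Submodule.add_mem _ h1 h2
  | smul r x _ h => simpa using Submodule.smul_mem _ r h

/-- The induced map `⋀^p M → ⋀^p N` of a linear map `f : M → N`. -/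
def extPowMap (p : ℕ) (f : M →ₗ[R] N) : (⋀[R]^p M) →ₗ[R] (⋀[R]^p N) :=
  (ExteriorAlgebra.map f).toLinearMap.restrict (fun _ hx => extPow_map_mem p f hx)

end ExtPow

section Wedge

variable (R L : Type) [CommRing R] [AddCommGroup L] [Module R L]

/-- Auxiliary map `L ⊗ L → Λ(L)`, `x ⊗ y ↦ ι x * ι y`. -/
def wedgeToAlg : L ⊗[R] L →ₗ[R] ExteriorAlgebra R L :=
  (LinearMap.mul' R (ExteriorAlgebra R L)).comp
    (TensorProduct.map (ExteriorAlgebra.ι R) (ExteriorAlgebra.ι R))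

lemma wedgeToAlg_mem (z : L ⊗[R] L) : wedgeToAlg R L z ∈ ⋀[R]^2 L := by
  induction z using TensorProduct.induction_on with
  | zero => simpa using Submodule.zero_mem _
  | tmul x y =>
      have : wedgeToAlg R L (x ⊗ₜ[R] y) =
          ExteriorAlgebra.ι R x * ExteriorAlgebra.ι R y := by
        simp [wedgeToAlg]
      have h2 : (⋀[R]^2 L) =
          LinearMap.range (ExteriorAlgebra.ι R (M := L)) *
            LinearMap.range (ExteriorAlgebra.ι R (M := L)) := pow_two _
      rw [this, h2]
      exact Submodule.mul_mem_mul (LinearMap.mem_range_self _ x) (LinearMap.mem_range_self _ y)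
  | add x y h1 h2 => simpa using Submodule.add_mem _ h1 h2

/-- The wedge product map `L ⊗ L → ⋀² L`, `x ⊗ y ↦ x ∧ y`. -/
def wedge2 : L ⊗[R] L →ₗ[R] (⋀[R]^2 L) :=
  (wedgeToAlg R L).codRestrict _ (wedgeToAlg_mem R L)

end Wedge

section ExtTor

variable (R : Type) [CommRing R]

/-- `Ext^i_R(M, N)` as an object of `ModuleCat R` (via the derived functor `Ext`). -/
abbrev ExtM (i : ℕ) (M N : Type) [AddCommGroup M] [Module R M] [AddCommGroup N] [Module R N] :
    ModuleCat R :=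
  ((Ext R (ModuleCat R) i).obj (Opposite.op (ModuleCat.of R M))).obj (ModuleCat.of R N)

/-- `Tor_i^R(M, N)` as an object of `ModuleCat R` (via the derived functor `Tor`). -/
abbrev TorM (i : ℕ) (M N : Type) [AddCommGroup M] [Module R M] [AddCommGroup N] [Module R N] :
    ModuleCat R :=
  ((Tor (ModuleCat R) i).obj (ModuleCat.of R M)).obj (ModuleCat.of R N)

/-- Isomorphism of `R`-modules, stated for objects of `ModuleCat R`. -/
def misoM {R : Type} [CommRing R] (X Y : ModuleCat R) : Prop := Nonempty (X ≅ Y)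

end ExtTor

section Schur

/-- The cells of the Young diagram whose `r`-th row has length `lens r`. -/
abbrev YoungCells (m : ℕ) (lens : Fin m → ℕ) : Type := Σ r : Fin m, Fin (lens r)

variable (R M : Type) [CommRing R] [AddCommGroup M] [Module R M]

/-- The action of a permutation of the index set on a tensor power. -/
def permAct {ι : Type} [Fintype ι] (σ : Equiv.Perm ι) :
    (⨂[R] _ : ι, M) →ₗ[R] (⨂[R] _ : ι, M) :=
  (PiTensorProduct.reindex R (fun _ : ι => M) σ).toLinearMap

open scoped Classical in
/-- The Young symmetrizer attached to the Young diagram with row lengths `lens`: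
`e = Σ_{σ ∈ RowStab} Σ_{τ ∈ ColStab} sgn(τ) • (σ τ)` acting on the tensor power of `M`
indexed by the cells of the diagram.  (We work in characteristic zero, where its image
is the Schur power `Σ^I M` for the partition `I` with conjugate row lengths `lens`.) -/
def youngSymmetrizer (m : ℕ) (lens : Fin m → ℕ) :
    (⨂[R] _ : YoungCells m lens, M) →ₗ[R] (⨂[R] _ : YoungCells m lens, M) :=
  ∑ σ : Equiv.Perm (YoungCells m lens), ∑ τ : Equiv.Perm (YoungCells m lens),
    if (∀ x, (σ x).1 = x.1) ∧ (∀ x, ((τ x).2 : ℕ) = ((x.2 : ℕ))) then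
      ((Equiv.Perm.sign τ : ℤ) • permAct R M (σ * τ))
    else 0

/-- The Schur power `Σ^I M` of `M`, for the partition `I` whose Young diagram has
row lengths `lens` (read as a Young diagram; rows of the diagram of `I`). -/
abbrev SchurPow (m : ℕ) (lens : Fin m → ℕ) : Type :=
  ↥(LinearMap.range (youngSymmetrizer R M m lens))

end Schur

section SymZ

variable {g t : ℕ} (A : Matrix (Fin g) (Fin t) (RR k n))

/-- Auxiliary: `SZ A 0 = Hom_R(M, R/I_t(A)) = S_{-1}M` and `SZ A (m+1) = S_m M`. -/
def SZ : ℕ → Type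
  | 0 => Mdl A →ₗ[RR k n] (RR k n ⧸ minors A t)
  | (m + 1) => SymPow (RR k n) (Mdl A) m

instance : ∀ m, AddCommGroup (SZ A m)
  | 0 => inferInstanceAs (AddCommGroup (Mdl A →ₗ[RR k n] (RR k n ⧸ minors A t)))
  | (m + 1) => inferInstanceAs (AddCommGroup (SymPow (RR k n) (Mdl A) m))

instance : ∀ m, Module (RR k n) (SZ A m)
  | 0 => inferInstanceAs (Module (RR k n) (Mdl A →ₗ[RR k n] (RR k n ⧸ minors A t)))
  | (m + 1) => inferInstanceAs (Module (RR k n) (SymPow (RR k n) (Mdl A) m))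

/-- `S_i M` for `i ∈ ℤ`, `i ≥ -1`:  `SymZ A (-1) = Hom(M, B_t)` and `SymZ A i = S_i M`
for `i ≥ 0` (junk value `Hom(M, B_t)` for `i < -1`). -/
abbrev SymZ (i : ℤ) : Type := SZ A (i + 1).toNat

end SymZ

section IdealTransform

variable {R : Type} [CommRing R] (J : Ideal R)
variable (N : Type) [AddCommGroup N] [Module R N]

/-- `Hom_R(Jᵛ, N)`. -/
abbrev homPow (ν : ℕ) : Type := ↥(J ^ ν) →ₗ[R] N

/-- Restriction `Hom(Jᵛ, N) → Hom(Jᵘ, N)` along `Jᵘ ⊆ Jᵛ` for `ν ≤ μ`. -/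
def homPowMap (ν μ : ℕ) (h : ν ≤ μ) : homPow J N ν →ₗ[R] homPow J N μ :=
  LinearMap.lcomp R N (Submodule.inclusion (Ideal.pow_le_pow_right h))

/-- The ideal transform `D_J(N) = colim_ν Hom_R(Jᵛ, N)`.  By Deligne's formula this
computes `H⁰_*(U, Ñ)` for `U` the complement of `V(J)`. -/
abbrev IdealTransform : Type := Module.DirectLimit (homPow J N) (homPowMap J N)

end IdealTransform

/-- A homogeneous ideal of `R = k[x₀,…,xₙ]`. -/
def IsHomogIdeal (I : Ideal (RR k n)) : Prop :=
  ∀ f ∈ I, ∀ d : ℕ, MvPolynomial.homogeneousComponent d f ∈ I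

/-- The identity element of `V ⊗ V*` for the free module `V = R^m` (both `V` and its
dual realized as `Fin m → R`). -/
def idElem (R : Type) [CommRing R] (m : ℕ) : (Fin m → R) ⊗[R] (Fin m → R) :=
  ∑ i : Fin m, (Pi.single i 1) ⊗ₜ[R] (Pi.single i 1)

end KMR

namespace KMR


section Statement11

variable {R : Type} [CommRing R]
variable (Q P F : ℤ → Type)
variable [∀ i, AddCommGroup (Q i)] [∀ i, Module R (Q i)]
variable [∀ i, AddCommGroup (P i)] [∀ i, Module R (P i)]
variable [∀ i, AddCommGroup (F i)] [∀ i, Module R (F i)]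

/-- The block differential
`(d_Q, 0, 0; σ, -d_P, 0; ℓ, -τ, d_F)` of the total complex
`Q_i ⊕ P_{i+1} ⊕ F_{i+2}` of Lemma `technicallemma`. -/
def blockD
    (dQ : ∀ i : ℤ, Q (i + 1) →ₗ[R] Q i) (dP : ∀ i : ℤ, P (i + 1) →ₗ[R] P i)
    (dF : ∀ i : ℤ, F (i + 1) →ₗ[R] F i)
    (σ : ∀ i : ℤ, Q i →ₗ[R] P i) (τ : ∀ i : ℤ, P i →ₗ[R] F i)
    (l : ∀ i : ℤ, Q i →ₗ[R] F (i + 1)) (i : ℤ) :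
    (Q (i + 1) × P (i + 1 + 1) × F (i + 1 + 1 + 1)) →ₗ[R]
      (Q i × P (i + 1) × F (i + 1 + 1)) :=
  let πQ := LinearMap.fst R (Q (i + 1)) (P (i + 1 + 1) × F (i + 1 + 1 + 1))
  let πP := (LinearMap.fst R (P (i + 1 + 1)) (F (i + 1 + 1 + 1))).comp
    (LinearMap.snd R (Q (i + 1)) (P (i + 1 + 1) × F (i + 1 + 1 + 1)))
  let πF := (LinearMap.snd R (P (i + 1 + 1)) (F (i + 1 + 1 + 1))).comp
    (LinearMap.snd R (Q (i + 1)) (P (i + 1 + 1) × F (i + 1 + 1 + 1)))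
  LinearMap.prod ((dQ i).comp πQ)
    (LinearMap.prod ((σ (i + 1)).comp πQ - (dP (i + 1)).comp πP)
      (((l (i + 1)).comp πQ - (τ (i + 1 + 1)).comp πP) + (dF (i + 1 + 1)).comp πF))

theorem blockD_apply
    (dQ : ∀ i : ℤ, Q (i + 1) →ₗ[R] Q i) (dP : ∀ i : ℤ, P (i + 1) →ₗ[R] P i)
    (dF : ∀ i : ℤ, F (i + 1) →ₗ[R] F i)
    (σ : ∀ i : ℤ, Q i →ₗ[R] P i) (τ : ∀ i : ℤ, P i →ₗ[R] F i)
    (l : ∀ i : ℤ, Q i →ₗ[R] F (i + 1)) (i : ℤ)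
    (q : Q (i + 1)) (p : P (i + 1 + 1)) (f : F (i + 1 + 1 + 1)) :
    blockD Q P F dQ dP dF σ τ l i (q, p, f) =
      (dQ i q, σ (i + 1) q - dP (i + 1) p,
        l (i + 1) q - τ (i + 1 + 1) p + dF (i + 1 + 1) f) :=
  rfl

/-- Where the `Q` and `P` summands vanish, the cokernel of the block differential is the
cokernel of the map induced by `τ`. -/
theorem nonempty_coker_blockD_equiv
    (dQ : ∀ i : ℤ, Q (i + 1) →ₗ[R] Q i) (dP : ∀ i : ℤ, P (i + 1) →ₗ[R] P i)
    (dF : ∀ i : ℤ, F (i + 1) →ₗ[R] F i)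
    (σ : ∀ i : ℤ, Q i →ₗ[R] P i) (τ : ∀ i : ℤ, P i →ₗ[R] F i)
    (l : ∀ i : ℤ, Q i →ₗ[R] F (i + 1)) {i j : ℤ} (hij : i + 1 + 1 = j)
    [Subsingleton (Q i)] [Subsingleton (Q (i + 1))] [Subsingleton (P (i + 1))]
    (hτle : LinearMap.range (dP j) ≤ (LinearMap.range (dF j)).comap (τ j)) :
    Nonempty
      (((Q i × P (i + 1) × F (i + 1 + 1)) ⧸
          LinearMap.range (blockD Q P F dQ dP dF σ τ l i)) ≃ₗ[R]
        ((F j ⧸ LinearMap.range (dF j)) ⧸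
          LinearMap.range
            (Submodule.mapQ (LinearMap.range (dP j)) (LinearMap.range (dF j)) (τ j) hτle))) := by
  subst hij
  let α := Submodule.mapQ (LinearMap.range (dP (i + 1 + 1)))
    (LinearMap.range (dF (i + 1 + 1))) (τ (i + 1 + 1)) hτle
  let π : (Q i × P (i + 1) × F (i + 1 + 1)) →ₗ[R] (_ ⧸ LinearMap.range α) :=
    (LinearMap.range α).mkQ ∘ₗ (LinearMap.range (dF (i + 1 + 1))).mkQ ∘ₗ
      LinearMap.snd R _ _ ∘ₗ LinearMap.snd R _ _
  have hπ : Function.Surjective π := by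
    intro x
    obtain ⟨y, rfl⟩ := Submodule.mkQ_surjective _ x
    obtain ⟨f, rfl⟩ := Submodule.mkQ_surjective _ y
    exact ⟨(0, 0, f), rfl⟩
  have hker : LinearMap.range (blockD Q P F dQ dP dF σ τ l i) = LinearMap.ker π := by
    ext ⟨q, p, f⟩
    have hmem : (q, p, f) ∈ LinearMap.ker π ↔
        (LinearMap.range (dF (i + 1 + 1))).mkQ f ∈ LinearMap.range α :=
      Submodule.Quotient.mk_eq_zero _
    rw [hmem]
    constructor
    · rintro ⟨⟨q', p', f'⟩, h⟩
      rw [blockD_apply, Prod.mk.injEq, Prod.mk.injEq, Subsingleton.elim q' 0,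
        (l (i + 1)).map_zero, zero_sub] at h
      refine ⟨Submodule.Quotient.mk (-p'), ?_⟩
      refine (Submodule.Quotient.eq _).2 ⟨-f', ?_⟩
      rw [← h.2.2, map_neg, map_neg]
      abel
    · rintro ⟨y, hy⟩
      obtain ⟨p', rfl⟩ := Submodule.mkQ_surjective _ y
      obtain ⟨f', hf'⟩ := (Submodule.Quotient.eq _).1 hy
      refine ⟨(0, -p', -f'), ?_⟩
      rw [blockD_apply]
      refine Prod.ext (Subsingleton.elim _ _) (Prod.ext (Subsingleton.elim _ _) ?_)
      simp only [map_neg, map_zero, hf']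
      abel
  exact ⟨(Submodule.quotEquivOfEq _ _ hker).trans (π.quotKerEquivOfSurjective hπ)⟩

/-- Lemma `technicallemma`, generalized mapping cone.
Given morphisms of complexes `Q• → P• → F•` (vanishing in negative degrees, acyclic),
such that `0 → coker d_Q¹ → coker d_P¹ → coker d_F¹` is exact, and a degree-one map
`ℓ• : Q• → F•[1]` with `d_F^{i+1} ℓ_i + ℓ_{i-1} d_Q^i = τ_i σ_i` for all `i`, the total
complex `Q_i ⊕ P_{i+1} ⊕ F_{i+2}` with the block differential is exact in every degree
`≠ -2`, and the cokernel of its differential `d^{-1}` is `coker α`. -/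
theorem statement_11
    (dQ : ∀ i : ℤ, Q (i + 1) →ₗ[R] Q i) (dP : ∀ i : ℤ, P (i + 1) →ₗ[R] P i)
    (dF : ∀ i : ℤ, F (i + 1) →ₗ[R] F i)
    (σ : ∀ i : ℤ, Q i →ₗ[R] P i) (τ : ∀ i : ℤ, P i →ₗ[R] F i)
    (l : ∀ i : ℤ, Q i →ₗ[R] F (i + 1))
    -- vanishing in negative degrees:
    (hQ0 : ∀ j : ℤ, j < 0 → Subsingleton (Q j))
    (hP0 : ∀ j : ℤ, j < 0 → Subsingleton (P j))
    (hF0 : ∀ j : ℤ, j < 0 → Subsingleton (F j))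
    -- σ and τ are morphisms of complexes:
    (hσ : ∀ i : ℤ, (σ i).comp (dQ i) = (dP i).comp (σ (i + 1)))
    (hτ : ∀ i : ℤ, (τ i).comp (dP i) = (dF i).comp (τ (i + 1)))
    -- the three complexes are acyclic (exact in all degrees ≠ 0):
    (hQex : ∀ i : ℤ, i + 1 ≠ 0 → Function.Exact (dQ (i + 1)) (dQ i))
    (hPex : ∀ i : ℤ, i + 1 ≠ 0 → Function.Exact (dP (i + 1)) (dP i))
    (hFex : ∀ i : ℤ, i + 1 ≠ 0 → Function.Exact (dF (i + 1)) (dF i))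
    -- the induced maps on the degree-0 cokernels exist and give an exact sequence
    -- `0 → coker d_Q¹ → coker d_P¹ →^α coker d_F¹`:
    (hσle : LinearMap.range (dQ 0) ≤ (LinearMap.range (dP 0)).comap (σ 0))
    (hτle : LinearMap.range (dP 0) ≤ (LinearMap.range (dF 0)).comap (τ 0))
    (hinj : Function.Injective
      (Submodule.mapQ (LinearMap.range (dQ 0)) (LinearMap.range (dP 0)) (σ 0) hσle))
    (hex0 : Function.Exact
      (Submodule.mapQ (LinearMap.range (dQ 0)) (LinearMap.range (dP 0)) (σ 0) hσle)
      (Submodule.mapQ (LinearMap.range (dP 0)) (LinearMap.range (dF 0)) (τ 0) hτle))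
    -- the homotopy-like identity `d_F^{i+1} ℓ_i + ℓ_{i-1} d_Q^i = τ_i σ_i`:
    (hl : ∀ i : ℤ, (dF (i + 1)).comp (l (i + 1)) + (l i).comp (dQ i)
      = (τ (i + 1)).comp (σ (i + 1))) :
    (∀ i : ℤ, i + 1 ≠ (-2 : ℤ) →
      Function.Exact (blockD Q P F dQ dP dF σ τ l (i + 1)) (blockD Q P F dQ dP dF σ τ l i)) ∧
    Nonempty
      (((Q (-2) × P (-2 + 1) × F (-2 + 1 + 1)) ⧸
          LinearMap.range (blockD Q P F dQ dP dF σ τ l (-2))) ≃ₗ[R]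
        ((F 0 ⧸ LinearMap.range (dF 0)) ⧸
          LinearMap.range
            (Submodule.mapQ (LinearMap.range (dP 0)) (LinearMap.range (dF 0)) (τ 0) hτle))) := by
  have hQd : ∀ i x, dQ i (dQ (i + 1) x) = 0 := fun i x => by
    by_cases h : i + 1 = 0
    · have := hQ0 i (by omega)
      exact Subsingleton.elim _ _
    · exact (hQex i h).apply_apply_eq_zero x
  have hPd : ∀ i x, dP i (dP (i + 1) x) = 0 := fun i x => by
    by_cases h : i + 1 = 0
    · have := hP0 i (by omega)
      exact Subsingleton.elim _ _
    · exact (hPex i h).apply_apply_eq_zero x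
  have hFd : ∀ i x, dF i (dF (i + 1) x) = 0 := fun i x => by
    by_cases h : i + 1 = 0
    · have := hF0 i (by omega)
      exact Subsingleton.elim _ _
    · exact (hFex i h).apply_apply_eq_zero x
  have hσ' : ∀ i x, σ i (dQ i x) = dP i (σ (i + 1) x) := fun i x => LinearMap.congr_fun (hσ i) x
  have hτ' : ∀ i x, τ i (dP i x) = dF i (τ (i + 1) x) := fun i x => LinearMap.congr_fun (hτ i) x
  have hl' : ∀ i x, dF (i + 1) (l (i + 1) x) + l i (dQ i x) = τ (i + 1) (σ (i + 1) x) :=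
    fun i x => LinearMap.congr_fun (hl i) x
  have hQlift : ∀ i : ℤ, i = 0 → ∀ q p, σ i q = dP i p → ∃ q', dQ i q' = q := by
    rintro _ rfl q p h
    refine (Submodule.Quotient.mk_eq_zero (LinearMap.range (dQ 0))).1 (hinj ?_)
    rw [map_zero]
    exact (Submodule.Quotient.mk_eq_zero _).2 ⟨p, h.symm⟩
  have hPlift : ∀ i : ℤ, i = 0 → ∀ p f, τ i p = dF i f → ∃ q' p', p = σ i q' - dP i p' := by
    rintro _ rfl p f h
    obtain ⟨y, hy⟩ := (hex0 (Submodule.Quotient.mk p)).1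
      ((Submodule.Quotient.mk_eq_zero _).2 ⟨f, h.symm⟩)
    obtain ⟨q', rfl⟩ := Submodule.mkQ_surjective _ y
    obtain ⟨p', hp'⟩ := (Submodule.Quotient.eq _).1 hy
    exact ⟨q', p', by rw [hp']; abel⟩
  refine ⟨fun i hi => ?_, ?_⟩
  · rintro ⟨q, p, f⟩
    constructor
    · intro h
      rw [blockD_apply, Prod.mk_eq_zero, Prod.mk_eq_zero] at h
      obtain ⟨h1, h2, h3⟩ := h
      have hqp : ∃ q' p', q = dQ (i + 1) q' ∧ p = σ (i + 1 + 1) q' - dP (i + 1 + 1) p' := by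
        rcases lt_or_ge (i + 1) 0 with hneg | hnn
        · have := hQ0 (i + 1) hneg
          by_cases h0 : i + 1 + 1 = 0
          · have hp : τ (i + 1 + 1) p = dF (i + 1 + 1) f := by
              rw [Subsingleton.elim q 0, map_zero, zero_sub] at h3
              exact neg_add_eq_zero.1 h3
            obtain ⟨q', p', hp'⟩ := hPlift _ h0 p f hp
            exact ⟨q', p', Subsingleton.elim _ _, hp'⟩
          · have := hP0 (i + 1 + 1) (by omega)
            exact ⟨0, 0, Subsingleton.elim _ _, Subsingleton.elim _ _⟩
        · obtain ⟨q', rfl⟩ : ∃ q', dQ (i + 1) q' = q := by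
            by_cases h0 : i + 1 = 0
            · exact hQlift _ h0 q p (sub_eq_zero.1 h2)
            · exact (hQex i h0 q).1 h1
          have hp : dP (i + 1) (σ (i + 1 + 1) q' - p) = 0 := by
            rw [map_sub, ← hσ', h2]
          obtain ⟨p', hp'⟩ := (hPex (i + 1) (by omega) _).1 hp
          exact ⟨q', p', rfl, by rw [hp']; abel⟩
      obtain ⟨q', p', rfl, rfl⟩ := hqp
      have hf : dF (i + 1 + 1) (f - l (i + 1 + 1) q' + τ (i + 1 + 1 + 1) p') = 0 := by
        rw [map_sub, hτ', ← hl' (i + 1) q'] at h3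
        rw [map_add, map_sub, ← h3]
        abel
      obtain ⟨f', hf'⟩ := (hFex (i + 1 + 1) (by omega) _).1 hf
      refine ⟨(q', p', f'), ?_⟩
      rw [blockD_apply, hf']
      refine Prod.ext rfl (Prod.ext rfl ?_)
      dsimp only
      abel
    · rintro ⟨⟨q', p', f'⟩, h⟩
      rw [← h, blockD_apply, blockD_apply, hQd, Prod.mk_eq_zero, Prod.mk_eq_zero]
      refine ⟨rfl, ?_, ?_⟩
      · rw [map_sub, hPd, hσ']
        abel
      · rw [map_sub, map_add, map_sub, hFd, hτ', ← hl' (i + 1) q']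
        abel
  · have := hQ0 (-2) (by decide)
    have := hQ0 (-2 + 1) (by decide)
    have := hP0 (-2 + 1) (by decide)
    exact nonempty_coker_blockD_equiv Q P F dQ dP dF σ τ l (by decide) hτle

end Statement11

end KMR
end
end

section
/- Let φ: F → G be a graded minimal morphism between free R-modules of ranks t and t+1 (c = 2), B_t := R/I_t(φ) standard determinantal, M = coker(φ*), J := I_{t−1}(φ), ℓ₂ := Σ_{j=1}^{t+1} a_j − Σ_{i=1}^{t} b_i, and assume depth_J B_t ≥ 4. Then the sequence 0 → M → F ⊗ S₂M → G ⊗ S₂M → (S₂M ⊗ I_t(φ))(ℓ₂) → 0 is exact. -/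
/-!
Common setup for formalizing "Schur powers of the cokernel of a graded morphism"
by J.O. Kleppe and R.M. Miró-Roig.
-/

open Matrix TensorProduct CategoryTheory

noncomputable section

namespace KMR


section ExtVanishing

variable {R : Type} [CommRing R]

/-- The module `Ext^i_R(R/J, N)`. -/
abbrev ExtQ (J : Ideal R) (N : Type) [AddCommGroup N] [Module R N] (i : ℕ) : Type :=
  Abelian.Ext (ModuleCat.of R (R ⧸ J)) (ModuleCat.of R N) i

/-- `Ext^i_R(R/J, N) = 0` for all `i < d`. -/
def ExtVanishes (J : Ideal R) (N : Type) [AddCommGroup N] [Module R N] (d : ℕ) : Prop :=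
  ∀ i < d, Subsingleton (ExtQ J N i)

variable {J : Ideal R} {N N₁ N₂ N₃ : Type} [AddCommGroup N] [Module R N]
  [AddCommGroup N₁] [Module R N₁] [AddCommGroup N₂] [Module R N₂] [AddCommGroup N₃] [Module R N₃]

/-- Functoriality of `Ext^i_R(R/J, -)`. -/
def extQMap (J : Ideal R) (i : ℕ) (f : N₁ →ₗ[R] N₂) : ExtQ J N₁ i →ₗ[R] ExtQ J N₂ i :=
  Abelian.Ext.postcompOfLinear (Abelian.Ext.mk₀ (ModuleCat.ofHom f)) R _ (add_zero i)

lemma extQMap_apply (i : ℕ) (f : N₁ →ₗ[R] N₂) (x : ExtQ J N₁ i) :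
    extQMap J i f x = x.comp (Abelian.Ext.mk₀ (ModuleCat.ofHom f)) (add_zero i) := rfl

lemma extQMap_id (i : ℕ) (x : ExtQ J N i) : extQMap J i LinearMap.id x = x := by
  simp [extQMap_apply]

lemma extQMap_comp (i : ℕ) (f : N₁ →ₗ[R] N₂) (g : N₂ →ₗ[R] N₃) (x : ExtQ J N₁ i) :
    extQMap J i (g ∘ₗ f) x = extQMap J i g (extQMap J i f x) := by
  simp [extQMap_apply]

lemma extQMap_zero (i : ℕ) (x : ExtQ J N₁ i) : extQMap J i (0 : N₁ →ₗ[R] N₂) x = 0 := by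
  simp [extQMap_apply]

lemma extQMap_add (i : ℕ) (f g : N₁ →ₗ[R] N₂) (x : ExtQ J N₁ i) :
    extQMap J i (f + g) x = extQMap J i f x + extQMap J i g x := by
  simp [extQMap_apply, Abelian.Ext.mk₀_add]

lemma extQMap_smul (i : ℕ) (r : R) (f : N₁ →ₗ[R] N₂) (x : ExtQ J N₁ i) :
    extQMap J i (r • f) x = r • extQMap J i f x := by
  rw [extQMap_apply, show ModuleCat.ofHom (r • f) = r • ModuleCat.ofHom f from rfl,
    Abelian.Ext.mk₀_smul, Abelian.Ext.comp_smul, extQMap_apply]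

lemma extQMap_sum {ι : Type} (s : Finset ι) (i : ℕ) (f : ι → N₁ →ₗ[R] N₂) (x : ExtQ J N₁ i) :
    extQMap J i (∑ a ∈ s, f a) x = ∑ a ∈ s, extQMap J i (f a) x := by
  classical
  induction s using Finset.induction_on with
  | empty => simp [extQMap_zero]
  | insert a s ha ih => rw [Finset.sum_insert ha, Finset.sum_insert ha, extQMap_add, ih]

lemma smul_extQ_eq_zero {r : R} (hr : r ∈ J) (i : ℕ) (x : ExtQ J N i) : r • x = 0 := by
  have h : r • 𝟙 (ModuleCat.of R (R ⧸ J)) = 0 := by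
    refine ModuleCat.hom_ext (LinearMap.ext fun y => ?_)
    obtain ⟨y, rfl⟩ := Ideal.Quotient.mk_surjective y
    change r • Ideal.Quotient.mk J y = 0
    rw [Algebra.smul_def, Ideal.Quotient.algebraMap_eq, Ideal.Quotient.eq_zero_iff_mem.2 hr,
      zero_mul]
  calc r • x = (Abelian.Ext.mk₀ (r • 𝟙 (ModuleCat.of R (R ⧸ J)))).comp x (zero_add i) := by
        rw [Abelian.Ext.mk₀_smul, Abelian.Ext.smul_comp, Abelian.Ext.mk₀_id_comp]
    _ = 0 := by rw [h, Abelian.Ext.mk₀_zero, Abelian.Ext.zero_comp]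

lemma ExtVanishes.of_eq_top (hJ : J = ⊤) (d : ℕ) : ExtVanishes J N d := fun i _ =>
  subsingleton_of_forall_eq 0 fun x => by
    have := smul_extQ_eq_zero (r := 1) (hJ ▸ Submodule.mem_top) i x
    rwa [one_smul] at this

lemma ExtVanishes.mono {d e : ℕ} (h : ExtVanishes J N d) (hde : e ≤ d) : ExtVanishes J N e :=
  fun i hi => h i (hi.trans_le hde)

lemma ExtVanishes.of_retract {d : ℕ} (h : ExtVanishes J N₂ d) (f : N₁ →ₗ[R] N₂) (g : N₂ →ₗ[R] N₁)
    (hgf : g ∘ₗ f = LinearMap.id) : ExtVanishes J N₁ d := fun i hi =>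
  subsingleton_of_forall_eq 0 fun x => by
    have := h i hi
    rw [← extQMap_id i x, ← hgf, extQMap_comp, Subsingleton.elim (extQMap J i f x) 0, map_zero]

lemma ExtVanishes.pi {ι : Type} [Fintype ι] {d : ℕ} (h : ExtVanishes J N d) :
    ExtVanishes J (ι → N) d := fun i hi => by
  classical
  refine subsingleton_of_forall_eq 0 fun x => ?_
  have := h i hi
  have hid : (LinearMap.id : (ι → N) →ₗ[R] (ι → N)) =
      ∑ a, LinearMap.single R (fun _ => N) a ∘ₗ LinearMap.proj a := by
    ext a y b
    simp [Finset.sum_apply, Pi.single_apply]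
  rw [← extQMap_id i x, hid, extQMap_sum]
  refine Finset.sum_eq_zero fun a _ => ?_
  rw [extQMap_comp, Subsingleton.elim (extQMap J i (LinearMap.proj a) x) 0, map_zero]

section ShortExact

variable {f : N₁ →ₗ[R] N₂} {g : N₂ →ₗ[R] N₃}

lemma shortExact_of_linearMap (hf : Function.Injective f) (hfg : Function.Exact f g)
    (hg : Function.Surjective g) :
    (ShortComplex.mk (ModuleCat.ofHom f) (ModuleCat.ofHom g) (by
      ext x
      exact hfg.apply_apply_eq_zero x)).ShortExact :=
  ModuleCat.shortComplex_shortExact _ hfg hf hg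

lemma extQMap_injective (hf : Function.Injective f) (hfg : Function.Exact f g)
    (hg : Function.Surjective g) {d : ℕ} (h₃ : ExtVanishes J N₃ d) {i : ℕ} (hi : i ≤ d) :
    Function.Injective (extQMap J i f) := by
  have hS := shortExact_of_linearMap hf hfg hg
  cases i with
  | zero =>
    have : Mono (ModuleCat.ofHom f) := (ModuleCat.mono_iff_injective _).2 hf
    exact Abelian.Ext.postcomp_mk₀_injective_of_mono _ (ModuleCat.ofHom f)
  | succ i =>
    rw [injective_iff_map_eq_zero]
    intro x hx
    obtain ⟨y, rfl⟩ := Abelian.Ext.covariant_sequence_exact₁ _ hS x hx rfl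
    have := h₃ i (by omega)
    have hy : y = 0 := Subsingleton.elim (α := ExtQ J N₃ i) _ _
    rw [hy, Abelian.Ext.zero_comp]

lemma ExtVanishes.of_left (hf : Function.Injective f) (hfg : Function.Exact f g)
    (hg : Function.Surjective g) {d : ℕ} (h₂ : ExtVanishes J N₂ (d + 1))
    (h₃ : ExtVanishes J N₃ d) : ExtVanishes J N₁ (d + 1) := fun i hi => by
  have := h₂ i hi
  exact (extQMap_injective hf hfg hg h₃ (Nat.lt_succ_iff.1 hi)).subsingleton

lemma ExtVanishes.of_right (hf : Function.Injective f) (hfg : Function.Exact f g)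
    (hg : Function.Surjective g) {d : ℕ} (h₁ : ExtVanishes J N₁ (d + 1))
    (h₂ : ExtVanishes J N₂ d) : ExtVanishes J N₃ d := fun i hi => by
  refine subsingleton_of_forall_eq 0 fun x => ?_
  have hS := shortExact_of_linearMap hf hfg hg
  have := h₁ (i + 1) (by omega)
  have := h₂ i hi
  obtain ⟨y, rfl⟩ := Abelian.Ext.covariant_sequence_exact₃ _ hS x rfl
    (Subsingleton.elim (α := ExtQ J N₁ (i + 1)) _ _)
  have hy : y = 0 := Subsingleton.elim (α := ExtQ J N₂ i) _ _
  rw [hy, Abelian.Ext.zero_comp]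

lemma ExtVanishes.coker {d : ℕ} (hf : Function.Injective f) (hfg : Function.Exact f g)
    (h₁ : ExtVanishes J N₁ (d + 2)) (h₂ : ExtVanishes J N₂ (d + 1)) (h₃ : ExtVanishes J N₃ d) :
    ExtVanishes J (N₃ ⧸ LinearMap.range g) d := by
  have h : ExtVanishes J (N₂ ⧸ LinearMap.range f) (d + 1) :=
    h₁.of_right hf (g := (LinearMap.range f).mkQ)
      (LinearMap.exact_iff.2 (Submodule.ker_mkQ _)) (Submodule.mkQ_surjective _) h₂
  have hr : LinearMap.range f = LinearMap.ker g := (LinearMap.exact_iff.1 hfg).symm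
  refine h.of_right (f := (LinearMap.range f).liftQ g hr.le) (g := (LinearMap.range g).mkQ)
    ?_ ?_ (Submodule.mkQ_surjective _) h₃
  · rw [← LinearMap.ker_eq_bot]
    exact Submodule.ker_liftQ_eq_bot _ _ _ hr.ge
  · rw [LinearMap.exact_iff, Submodule.ker_mkQ, Submodule.range_liftQ]

end ShortExact

/-- If `Hom(R/J, N) = 0`, no nonzero element of `N` is killed by `J`. -/
lemma ExtVanishes.eq_zero_of_smul_eq_zero (h : ExtVanishes J N 1) {x : N}
    (hx : ∀ r ∈ J, r • x = 0) : x = 0 := by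
  have := h 0 one_pos
  have hle : J ≤ LinearMap.ker (LinearMap.toSpanSingleton R N x) := fun r hr => hx r hr
  let φ : (R ⧸ J) →ₗ[R] N := Submodule.liftQ J (LinearMap.toSpanSingleton R N x) hle
  have h0 : (Abelian.Ext.mk₀ (ModuleCat.ofHom φ) : ExtQ J N 0) =
      Abelian.Ext.mk₀ (0 : ModuleCat.of R (R ⧸ J) ⟶ ModuleCat.of R N) := Subsingleton.elim _ _
  have h1 : ModuleCat.ofHom φ = 0 := Abelian.Ext.homEquiv₀.symm.injective h0
  have h2 : φ (Submodule.Quotient.mk 1) = 0 := by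
    have := congrArg (fun q => q.hom (Submodule.Quotient.mk 1)) h1
    exact this
  have h3 : φ (Submodule.Quotient.mk 1) = LinearMap.toSpanSingleton R N x 1 :=
    Submodule.liftQ_apply _ _ _
  rw [h2] at h3
  simpa using h3.symm

/-- If `Ext¹(R/J, N) = 0`, every linear map `J → N` is multiplication by an element of `N`. -/
lemma ExtVanishes.exists_eq_smul (h : ExtVanishes J N 2) (ψ : J →ₗ[R] N) :
    ∃ x : N, ∀ r : J, ψ r = (r : R) • x := by
  have := h 1 one_lt_two
  have hS := shortExact_of_linearMap (f := J.subtype) (g := Submodule.mkQ J)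
    (Submodule.subtype_injective _)
    (by rw [LinearMap.exact_iff, Submodule.ker_mkQ]; exact (Submodule.range_subtype J).symm)
    (Submodule.mkQ_surjective _)
  obtain ⟨y, hy⟩ := Abelian.Ext.contravariant_sequence_exact₁ hS _
    (Abelian.Ext.mk₀ (ModuleCat.ofHom ψ)) (n₁ := 1) rfl
    (Subsingleton.elim (α := ExtQ J N 1) _ _)
  obtain ⟨y, rfl⟩ := Abelian.Ext.homEquiv₀.symm.surjective y
  rw [Abelian.Ext.homEquiv₀_symm_apply, Abelian.Ext.mk₀_comp_mk₀] at hy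
  have h1 := Abelian.Ext.homEquiv₀.symm.injective hy
  refine ⟨y.hom (1 : R), fun r => ?_⟩
  have h2 := congrArg (fun q => q.hom r) h1
  have h3 : y.hom (r : R) = ψ r := h2
  rw [← h3, ← map_smul, smul_eq_mul, mul_one]

/-- McCoy's theorem: a matrix whose maximal minors kill a nonzero module `E` has a nonzero
vector with entries in `E` in its kernel. -/
lemma exists_ne_zero_of_minors_smul_eq_zero {g t : ℕ} (A : Matrix (Fin g) (Fin t) R)
    {E : Type} [AddCommGroup E] [Module R E] [Nontrivial E]
    (hE : ∀ (r : Fin t → Fin g) (c : Fin t → Fin t), Function.Injective r → Function.Injective c →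
      ∀ e : E, (A.submatrix r c).det • e = 0) :
    ∃ v : Fin t → E, v ≠ 0 ∧ ∀ j, ∑ i, A j i • v i = 0 := by
  classical
  let p : ℕ → Prop := fun m => ∃ (r : Fin m → Fin g) (c : Fin m → Fin t) (e : E),
    (A.submatrix r c).det • e ≠ 0
  have inj_c : ∀ {m : ℕ} {r : Fin m → Fin g} {c : Fin m → Fin t} {e : E},
      (A.submatrix r c).det • e ≠ 0 → Function.Injective r ∧ Function.Injective c := by
    intro m r c e h
    constructor
    · intro a b hab
      by_contra hne
      exact h (by rw [Matrix.det_zero_of_row_eq hne (by ext; simp [hab]), zero_smul])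
    · intro a b hab
      by_contra hne
      exact h (by rw [Matrix.det_zero_of_column_eq hne (by simp [hab]), zero_smul])
  have p0 : p 0 := by
    obtain ⟨e, he⟩ := exists_ne (0 : E)
    exact ⟨Fin.elim0, Fin.elim0, e, by simpa using he⟩
  have pt : ¬ p t := fun ⟨r, c, e, h⟩ => h (hE r c (inj_c h).1 (inj_c h).2 e)
  obtain ⟨m, hm, hm'⟩ : ∃ m, p m ∧ ¬ p (m + 1) := by
    by_contra! hcon
    exact pt (Nat.rec p0 (fun m hm => hcon m hm) t)
  obtain ⟨r, c, e, h⟩ := hm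
  have hc := (inj_c h).2
  have hmt : m < t := by
    refine lt_of_le_of_ne (by simpa using Fintype.card_le_of_injective c hc) ?_
    rintro rfl
    exact pt ⟨r, c, e, h⟩
  obtain ⟨c₀, hc₀⟩ : ∃ c₀, c₀ ∉ Set.range c := by
    by_contra! hcon
    have := Fintype.card_le_of_surjective c hcon
    simp at this
    omega
  let c' : Fin (m + 1) → Fin t := Fin.cons c₀ c
  let w : Fin (m + 1) → R := fun l => (-1) ^ (l : ℕ) * (A.submatrix r (c' ∘ l.succAbove)).det
  refine ⟨∑ l, Pi.single (c' l) (w l • e), ?_, fun j => ?_⟩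
  · intro h0
    have := congrFun h0 c₀
    rw [Finset.sum_apply, Fin.sum_univ_succ, Finset.sum_eq_zero, add_zero] at this
    · refine h ?_
      have hcc : c' ∘ Fin.succ = c := by ext; simp [c']
      simpa [c', w, hcc] using this
    · intro l _
      have : c₀ ≠ c' l.succ := fun hl => hc₀ ⟨l, by simpa [c'] using hl.symm⟩
      rw [Pi.single_eq_of_ne this]
  · have hdet : (A.submatrix (Fin.cons j r : Fin (m + 1) → Fin g) c').det • e = 0 := by
      by_contra hne
      exact hm' ⟨_, _, e, hne⟩
    rw [Matrix.det_succ_row_zero, Finset.sum_smul] at hdet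
    simp_rw [Finset.sum_apply, Finset.smul_sum]
    rw [Finset.sum_comm, ← hdet]
    refine Finset.sum_congr rfl fun l _ => ?_
    rw [Finset.sum_eq_single (c' l)]
    · rw [Pi.single_eq_same, smul_smul]
      congr 1
      have : ((A.submatrix (Fin.cons j r : Fin (m + 1) → Fin g) c').submatrix Fin.succ
          l.succAbove) = A.submatrix r (c' ∘ l.succAbove) := by
        ext; simp
      rw [this]
      simp [w]
      ring
    · intro b _ hb
      rw [Pi.single_eq_of_ne hb, smul_zero]
    · simp

/-- If `0 → R^t → R^g → R → B → 0` is exact with `R^t → R^g` given by a matrix whose maximal minors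
lie in `J`, then vanishing of `Ext^i(R/J, B)` for `i < d` forces that of `Ext^i(R/J, R)`. -/
lemma ExtVanishes.of_resolution {g t : ℕ} (A : Matrix (Fin g) (Fin t) R) {I : Ideal R}
    (hIJ : I ≤ J)
    (hI : ∀ (r : Fin t → Fin g) (c : Fin t → Fin t), Function.Injective r → Function.Injective c →
      (A.submatrix r c).det ∈ I)
    (hA : Function.Injective A.mulVecLin) (γ : (Fin g → R) →ₗ[R] I)
    (hγ : Function.Surjective γ) (hAγ : Function.Exact A.mulVecLin γ) {d : ℕ}
    (hB : ExtVanishes J (R ⧸ I) d) : ExtVanishes J R d := by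
  suffices H : ∀ e ≤ d, ExtVanishes J R e from H d le_rfl
  intro e
  induction e with
  | zero => exact fun _ i hi => absurd hi (Nat.not_lt_zero i)
  | succ e ih =>
    intro he i hi
    rcases Nat.lt_succ_iff_lt_or_eq.1 hi with hi | rfl
    · exact ih (by omega) i hi
    by_contra hnt
    rw [not_subsingleton_iff_nontrivial] at hnt
    have hRi : ExtVanishes J R i := ih (by omega)
    have hIi : ExtVanishes J I i := by
      cases i with
      | zero => exact fun i hi => absurd hi (Nat.not_lt_zero i)
      | succ i =>
        exact hRi.of_left (f := I.subtype) (g := Submodule.mkQ I) (Submodule.subtype_injective _)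
          (by rw [LinearMap.exact_iff, Submodule.ker_mkQ]; exact (Submodule.range_subtype I).symm)
          (Submodule.mkQ_surjective _) (hB.mono (by omega))
    have hinj := extQMap_injective hA hAγ hγ hIi le_rfl
    obtain ⟨v, hv, hAv⟩ := exists_ne_zero_of_minors_smul_eq_zero A (E := ExtQ J R i)
      fun r c hr hc x => smul_extQ_eq_zero (hIJ (hI r c hr hc)) i x
    refine hv (funext fun b => ?_)
    let ξ : ExtQ J (Fin t → R) i := ∑ a, extQMap J i (LinearMap.single R (fun _ => R) a) (v a)
    have hξ : extQMap J i A.mulVecLin ξ = 0 := by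
      have key : ∀ a, A.mulVecLin ∘ₗ LinearMap.single R (fun _ => R) a =
          ∑ j, A j a • LinearMap.single R (fun _ => R) j := by
        intro a
        ext j
        simp [Finset.sum_apply, Pi.single_apply, Matrix.mulVec_single]
      simp_rw [ξ, map_sum, ← extQMap_comp, key, extQMap_sum, extQMap_smul, ← map_smul]
      rw [Finset.sum_comm]
      refine Finset.sum_eq_zero fun j _ => ?_
      rw [← map_sum, hAv, map_zero]
    have hξ0 : ξ = 0 := hinj (by rw [hξ, map_zero])
    have hproj : extQMap J i (LinearMap.proj b) ξ = v b := by
      simp_rw [ξ, map_sum, ← extQMap_comp]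
      rw [Finset.sum_eq_single b]
      · rw [LinearMap.proj_comp_single_same, extQMap_id]
      · intro a _ hab
        rw [LinearMap.proj_comp_single_ne _ _ _ _ hab.symm, extQMap_zero]
      · simp
    rw [← hproj, hξ0, map_zero, Pi.zero_apply]

end ExtVanishing

section HilbertBurch

variable {R : Type} [CommRing R] {t : ℕ}

/-- The signed maximal minors of a `(t+1) × t` matrix. -/
def signedMinor (A : Matrix (Fin (t + 1)) (Fin t) R) (i : Fin (t + 1)) : R :=
  (-1) ^ (i : ℕ) * (A.submatrix i.succAbove id).det

lemma transpose_mulVec_signedMinor (A : Matrix (Fin (t + 1)) (Fin t) R) :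
    Aᵀ *ᵥ signedMinor A = 0 := by
  ext b
  let M : Matrix (Fin (t + 1)) (Fin (t + 1)) R := fun i => Fin.cons (A i b) (A i)
  have hM : M.det = 0 :=
    Matrix.det_zero_of_column_eq (Fin.succ_ne_zero b).symm (by intro i; simp [M])
  rw [Matrix.det_succ_column_zero] at hM
  rw [Pi.zero_apply, ← hM, Matrix.mulVec, dotProduct]
  refine Finset.sum_congr rfl fun i _ => ?_
  have : M.submatrix i.succAbove Fin.succ = A.submatrix i.succAbove id := by
    ext; rfl
  rw [this]
  simp [M, signedMinor]
  ring

/-- The ideal of maximal minors of a `(t+1) × t` matrix. -/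
def maxMinors (A : Matrix (Fin (t + 1)) (Fin t) R) : Ideal R :=
  Ideal.span (Set.range (signedMinor A))

lemma signedMinor_mem (A : Matrix (Fin (t + 1)) (Fin t) R) (i : Fin (t + 1)) :
    signedMinor A i ∈ maxMinors A := Ideal.subset_span ⟨i, rfl⟩

lemma det_submatrix_mem_maxMinors (A : Matrix (Fin (t + 1)) (Fin t) R) (r : Fin t → Fin (t + 1))
    (c : Fin t → Fin t) (hr : Function.Injective r) (hc : Function.Injective c) :
    (A.submatrix r c).det ∈ maxMinors A := by
  obtain ⟨j, hj⟩ : ∃ j, j ∉ Set.range r := by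
    by_contra! hcon
    have := Fintype.card_le_of_surjective r hcon
    simp at this
  have hex : ∀ a, ∃ b, j.succAbove b = r a := fun a =>
    Fin.exists_succAbove_eq fun h => hj ⟨a, h⟩
  choose σ hσ using hex
  have hσi : Function.Injective σ := fun a b h => hr (by rw [← hσ, ← hσ, h])
  let eσ := Equiv.ofBijective σ (Finite.injective_iff_bijective.1 hσi)
  let ec := Equiv.ofBijective c (Finite.injective_iff_bijective.1 hc)
  have h1 : A.submatrix r c = ((A.submatrix j.succAbove id).submatrix eσ id).submatrix id ec := by
    ext a b
    simp [eσ, ec, hσ]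
  rw [h1, Matrix.det_permute', Matrix.det_permute]
  refine Ideal.mul_mem_left _ _ (Ideal.mul_mem_left _ _ ?_)
  have h2 : (A.submatrix j.succAbove id).det = (-1) ^ (j : ℕ) * signedMinor A j := by
    rw [signedMinor, ← mul_assoc, ← mul_pow]
    simp
  rw [h2]
  exact Ideal.mul_mem_left _ _ (signedMinor_mem A j)

lemma exists_mul_eq_smul_one (A : Matrix (Fin (t + 1)) (Fin t) R) {f : R} (hf : f ∈ maxMinors A) :
    ∃ N : Matrix (Fin t) (Fin (t + 1)) R, N * A = f • (1 : Matrix (Fin t) (Fin t) R) := by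
  induction hf using Submodule.span_induction with
  | mem x hx =>
    obtain ⟨i, rfl⟩ := hx
    refine ⟨(-1 : R) ^ (i : ℕ) • ((A.submatrix i.succAbove id).adjugate *
      (1 : Matrix (Fin (t + 1)) (Fin (t + 1)) R).submatrix i.succAbove id), ?_⟩
    have h : (1 : Matrix (Fin (t + 1)) (Fin (t + 1)) R).submatrix i.succAbove id * A =
        A.submatrix i.succAbove id := by
      ext a b
      simp [Matrix.mul_apply, Matrix.one_apply]
    rw [Matrix.smul_mul, Matrix.mul_assoc, h, Matrix.adjugate_mul, smul_smul]
    rfl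
  | zero => exact ⟨0, by simp⟩
  | add x y _ _ hx hy =>
    obtain ⟨N, hN⟩ := hx
    obtain ⟨N', hN'⟩ := hy
    exact ⟨N + N', by rw [Matrix.add_mul, hN, hN', add_smul]⟩
  | smul a x _ hx =>
    obtain ⟨N, hN⟩ := hx
    exact ⟨a • N, by rw [Matrix.smul_mul, hN, smul_smul, smul_eq_mul]⟩

/-- `f ≠ 0` and `g` is a nonzerodivisor modulo `f`. -/
def IsRegularPair (f g : R) : Prop := f ≠ 0 ∧ ∀ a b, g * a = f * b → ∃ a', a = f * a'

lemma isRegularPair_of_isRegular [Nontrivial R] {f g : R}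
    (h : RingTheory.Sequence.IsRegular R [f, g]) : IsRegularPair f g := by
  have h1 := h.toIsWeaklyRegular
  rw [RingTheory.Sequence.isWeaklyRegular_cons_iff,
    RingTheory.Sequence.isWeaklyRegular_cons_iff] at h1
  obtain ⟨hf, hg, -⟩ := h1
  refine ⟨?_, fun a b hab => ?_⟩
  · rintro rfl
    exact one_ne_zero (hf (show (0 : R) • (1 : R) = (0 : R) • 0 by simp))
  · have h2 : (Submodule.Quotient.mk a : QuotSMulTop f R) = 0 := by
      refine hg ?_
      change g • (Submodule.Quotient.mk a : QuotSMulTop f R) = g • 0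
      rw [smul_zero, ← Submodule.Quotient.mk_smul, Submodule.Quotient.mk_eq_zero]
      exact Submodule.mem_smul_pointwise_iff_exists _ _ _ |>.2 ⟨b, trivial, hab.symm⟩
    rw [Submodule.Quotient.mk_eq_zero, Submodule.mem_smul_pointwise_iff_exists] at h2
    obtain ⟨a', -, ha'⟩ := h2
    exact ⟨a', ha'.symm⟩

variable [IsDomain R]

lemma IsRegularPair.sq {f g : R} (h : IsRegularPair f g) : IsRegularPair (f ^ 2) (g ^ 2) := by
  have key : ∀ a b, g ^ 2 * a = f * b → ∃ a', a = f * a' := by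
    intro a b hab
    obtain ⟨c, hc⟩ := h.2 (g * a) b (by rw [← hab]; ring)
    exact h.2 a c hc
  refine ⟨pow_ne_zero 2 h.1, fun a b hab => ?_⟩
  obtain ⟨a₁, rfl⟩ := key a (f * b) (by rw [hab]; ring)
  obtain ⟨a₂, rfl⟩ := key a₁ b (mul_left_cancel₀ h.1 (by linear_combination hab))
  exact ⟨a₂, by ring⟩

variable {A : Matrix (Fin (t + 1)) (Fin t) R} {f g : R}

lemma mulVec_injective_of_mem_maxMinors (hf : f ∈ maxMinors A) (hf0 : f ≠ 0) :
    Function.Injective A.mulVecLin := by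
  obtain ⟨N, hN⟩ := exists_mul_eq_smul_one A hf
  rw [injective_iff_map_eq_zero]
  intro v hv
  have : N *ᵥ (A *ᵥ v) = 0 := by
    rw [show A *ᵥ v = 0 from hv, Matrix.mulVec_zero]
  rw [Matrix.mulVec_mulVec, hN, Matrix.smul_mulVec, Matrix.one_mulVec] at this
  exact (smul_eq_zero.1 this).resolve_left hf0

lemma exists_signedMinor_ne_zero (hf : f ∈ maxMinors A) (hf0 : f ≠ 0) :
    ∃ i, signedMinor A i ≠ 0 := by
  by_contra! hcon
  refine hf0 ?_
  have : maxMinors A ≤ ⊥ := Ideal.span_le.2 (by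
    rintro _ ⟨i, rfl⟩
    exact hcon i)
  simpa using this hf

lemma signedMinor_smul_mem_span {u : Fin (t + 1) → R} (hu : Aᵀ *ᵥ u = 0) (i : Fin (t + 1)) :
    ∃ s : R, signedMinor A i • u = s • signedMinor A := by
  by_cases hi : signedMinor A i = 0
  · exact ⟨0, by simp [hi]⟩
  refine ⟨u i, ?_⟩
  let w := signedMinor A i • u - u i • signedMinor A
  have hw : Aᵀ *ᵥ w = 0 := by
    simp [w, Matrix.mulVec_sub, Matrix.mulVec_smul, hu, transpose_mulVec_signedMinor]
  have hwi : w i = 0 := by simp [w, mul_comm]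
  have hdet : (A.submatrix i.succAbove id)ᵀ.det ≠ 0 := by
    rw [Matrix.det_transpose]
    exact fun h => hi (by rw [signedMinor, h, mul_zero])
  have h0 : (A.submatrix i.succAbove id)ᵀ *ᵥ (w ∘ i.succAbove) = 0 := by
    ext b
    have := congrFun hw b
    rw [Matrix.mulVec, dotProduct, Fin.sum_univ_succAbove _ i, hwi, mul_zero, zero_add] at this
    exact this
  have h1 := Matrix.eq_zero_of_mulVec_eq_zero hdet h0
  have h2 : w = 0 := by
    ext j
    rcases Fin.eq_self_or_eq_succAbove i j with rfl | ⟨j, rfl⟩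
    · exact hwi
    · exact congrFun h1 j
  exact sub_eq_zero.1 h2

lemma smul_mem_span_signedMinor {u : Fin (t + 1) → R} (hu : Aᵀ *ᵥ u = 0) (hf : f ∈ maxMinors A) :
    ∃ s : R, f • u = s • signedMinor A := by
  induction hf using Submodule.span_induction with
  | mem x hx =>
    obtain ⟨i, rfl⟩ := hx
    exact signedMinor_smul_mem_span hu i
  | zero => exact ⟨0, by simp⟩
  | add x y _ _ hx hy =>
    obtain ⟨s, hs⟩ := hx
    obtain ⟨s', hs'⟩ := hy
    exact ⟨s + s', by rw [add_smul, hs, hs', add_smul]⟩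
  | smul a x _ hx =>
    obtain ⟨s, hs⟩ := hx
    exact ⟨a * s, by rw [smul_eq_mul, mul_smul, hs, mul_smul]⟩

lemma exists_eq_smul_signedMinor (hf : f ∈ maxMinors A) (hg : g ∈ maxMinors A)
    (hfg : IsRegularPair f g) {u : Fin (t + 1) → R} (hu : Aᵀ *ᵥ u = 0) :
    ∃ s : R, u = s • signedMinor A := by
  obtain ⟨s, hs⟩ := smul_mem_span_signedMinor hu hf
  obtain ⟨s', hs'⟩ := smul_mem_span_signedMinor hu hg
  obtain ⟨i, hi⟩ := exists_signedMinor_ne_zero hf hfg.1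
  have e1 : f * u i = s * signedMinor A i := congrFun hs i
  have e2 : g * u i = s' * signedMinor A i := congrFun hs' i
  obtain ⟨s'', rfl⟩ := hfg.2 s s' (mul_right_cancel₀ hi (by linear_combination f * e2 - g * e1))
  refine ⟨s'', smul_right_injective _ hfg.1 ?_⟩
  simp only
  rw [hs, mul_smul]

lemma exists_eq_mulVec (hf : f ∈ maxMinors A) (hg : g ∈ maxMinors A)
    (hfg : IsRegularPair f g) {u : Fin (t + 1) → R} (hu : signedMinor A ⬝ᵥ u = 0) :
    ∃ v, A *ᵥ v = u := by
  have key : ∀ x ∈ maxMinors A, ∃ v, x • u = A *ᵥ v := by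
    intro x hx
    obtain ⟨N, hN⟩ := exists_mul_eq_smul_one A hx
    refine ⟨N *ᵥ u, ?_⟩
    let e : Matrix (Fin (t + 1)) (Fin (t + 1)) R := x • 1 - A * N
    have he : e * A = 0 := by
      simp [e, Matrix.sub_mul, Matrix.mul_assoc, hN]
    have heu : e *ᵥ u = 0 := by
      ext i
      have h1 : Aᵀ *ᵥ (e i) = 0 := by
        ext b
        rw [Matrix.mulVec_transpose]
        exact congrFun (congrFun he i) b
      obtain ⟨s, hs⟩ := exists_eq_smul_signedMinor hf hg hfg h1
      rw [Matrix.mulVec, hs, smul_dotProduct, hu, smul_zero, Pi.zero_apply]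
    rw [Matrix.sub_mulVec, Matrix.smul_mulVec, Matrix.one_mulVec, sub_eq_zero] at heu
    rw [heu, Matrix.mulVec_mulVec]
  obtain ⟨v, hv⟩ := key f hf
  obtain ⟨w, hw⟩ := key g hg
  have h1 : g • v = f • w := by
    refine mulVec_injective_of_mem_maxMinors hf hfg.1 ?_
    rw [map_smul, map_smul, Matrix.mulVecLin_apply, Matrix.mulVecLin_apply, ← hv, ← hw,
      smul_comm]
  choose v' hv' using fun i => hfg.2 (v i) (w i) (congrFun h1 i)
  refine ⟨v', smul_right_injective _ hfg.1 ?_⟩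
  simp only
  rw [hv, ← Matrix.mulVec_smul]
  congr 1
  ext i
  exact (hv' i).symm

end HilbertBurch

section SymmetricSquare

variable {R : Type} [CommRing R] {t : ℕ}

/-- Skew-symmetric matrices. -/
def skewMatrices (R : Type) [CommRing R] (m : ℕ) : Submodule R (Matrix (Fin m) (Fin m) R) where
  carrier := {C | Cᵀ = -C}
  add_mem' {C D} hC hD := by
    change (C + D)ᵀ = -(C + D)
    rw [Matrix.transpose_add, show Cᵀ = -C from hC, show Dᵀ = -D from hD, neg_add]
  zero_mem' := by simp
  smul_mem' r C hC := by
    change (r • C)ᵀ = -(r • C)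
    rw [Matrix.transpose_smul, show Cᵀ = -C from hC, smul_neg]

/-- Multiplication of skew-symmetric matrices by `A` on the right. -/
def skewMul (A : Matrix (Fin (t + 1)) (Fin t) R) :
    skewMatrices R (t + 1) →ₗ[R] Matrix (Fin (t + 1)) (Fin t) R where
  toFun C := C.1 * A
  map_add' C D := by simp [Matrix.add_mul]
  map_smul' r C := by simp

/-- The map `Q ↦ AᵀQ + QᵀA` to the symmetric matrices. -/
def symMul (A : Matrix (Fin (t + 1)) (Fin t) R) :
    Matrix (Fin (t + 1)) (Fin t) R →ₗ[R] Matrix (Fin t) (Fin t) R where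
  toFun Q := Aᵀ * Q + Qᵀ * A
  map_add' P Q := by
    rw [Matrix.mul_add, Matrix.transpose_add, Matrix.add_mul]
    abel
  map_smul' r Q := by simp [smul_add]

lemma ExtVanishes.skewMatrices [Invertible (2 : R)] {J : Ideal R} {d m : ℕ}
    (h : ExtVanishes J R d) : ExtVanishes J (skewMatrices R m) d := by
  have h' : ExtVanishes J (Matrix (Fin m) (Fin m) R) d := (h.pi (ι := Fin m)).pi (ι := Fin m)
  let p : Matrix (Fin m) (Fin m) R →ₗ[R] KMR.skewMatrices R m :=
    { toFun := fun C => ⟨⅟(2 : R) • (C - Cᵀ), by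
        change (⅟(2 : R) • (C - Cᵀ))ᵀ = -(⅟(2 : R) • (C - Cᵀ))
        rw [Matrix.transpose_smul, Matrix.transpose_sub, Matrix.transpose_transpose, ← smul_neg,
          neg_sub]⟩
      map_add' := fun C D => by
        ext1
        change ⅟(2 : R) • (C + D - (C + D)ᵀ) = ⅟(2 : R) • (C - Cᵀ) + ⅟(2 : R) • (D - Dᵀ)
        rw [Matrix.transpose_add, ← smul_add]
        congr 1
        abel
      map_smul' := fun r C => by
        ext1
        change ⅟(2 : R) • (r • C - (r • C)ᵀ) = r • ⅟(2 : R) • (C - Cᵀ)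
        rw [Matrix.transpose_smul, ← smul_sub, smul_comm] }
  refine h'.of_retract (Submodule.subtype _) p ?_
  ext1 C
  ext1
  change ⅟(2 : R) • (C.1 - C.1ᵀ) = C.1
  rw [show C.1ᵀ = -C.1 from C.2, sub_neg_eq_add, ← two_smul R, smul_smul, invOf_mul_self, one_smul]

variable [IsDomain R] {A : Matrix (Fin (t + 1)) (Fin t) R} {f g : R}

lemma skewMul_injective (h2 : (2 : R) ≠ 0) (hf : f ∈ maxMinors A) (hg : g ∈ maxMinors A)
    (hfg : IsRegularPair f g) : Function.Injective (skewMul A) := by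
  rw [injective_iff_map_eq_zero]
  rintro ⟨C, hC⟩ hCA
  have hCA : C * A = 0 := hCA
  have hskew : ∀ i j, C j i = - C i j := fun i j => congrFun (congrFun hC i) j
  have h1 : ∀ i, ∃ s : R, C i = s • signedMinor A := fun i => by
    refine exists_eq_smul_signedMinor hf hg hfg ?_
    rw [Matrix.mulVec_transpose]
    exact congrFun hCA i
  choose s hs using h1
  have hs' : ∀ i j, C i j = s i * signedMinor A j := fun i j => congrFun (hs i) j
  have hd : ∀ i, s i * signedMinor A i = 0 := by
    intro i
    rw [← hs']
    have : (2 : R) * C i i = 0 := by linear_combination hskew i i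
    exact (mul_eq_zero.1 this).resolve_left h2
  obtain ⟨j, hj⟩ := exists_signedMinor_ne_zero hf hfg.1
  have hs0 : ∀ i, s i = 0 := by
    intro i
    have e := hskew i j
    rw [hs', hs'] at e
    have : s i * (signedMinor A j * signedMinor A j) = 0 := by
      linear_combination signedMinor A j * e - signedMinor A i * hd j
    exact (mul_eq_zero.1 this).resolve_right (mul_ne_zero hj hj)
  ext i j
  simp [hs', hs0]

lemma exists_sq_smul_eq_skewMul {Q : Matrix (Fin (t + 1)) (Fin t) R} (hQ : Aᵀ * Q + Qᵀ * A = 0)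
    (hf : f ∈ maxMinors A) : ∃ C, skewMul A C = f ^ 2 • Q := by
  obtain ⟨N, hN⟩ := exists_mul_eq_smul_one A hf
  let e : Matrix (Fin (t + 1)) (Fin (t + 1)) R := f • 1 - A * N
  have he : e * A = 0 := by simp [e, Matrix.sub_mul, Matrix.mul_assoc, hN]
  have heT : eᵀ = f • 1 - Nᵀ * Aᵀ := by simp [e, Matrix.transpose_sub, Matrix.transpose_mul]
  have hX : Qᵀ * A = -(Aᵀ * Q) := eq_neg_of_add_eq_zero_right hQ
  refine ⟨⟨Nᵀ * (Aᵀ * Q) * N + eᵀ * Q * N - Nᵀ * (Qᵀ * e), ?_⟩, ?_⟩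
  · change (_)ᵀ = -(_)
    simp only [Matrix.transpose_sub, Matrix.transpose_add, Matrix.transpose_mul,
      Matrix.transpose_transpose, hX, Matrix.mul_neg, Matrix.neg_mul, Matrix.mul_assoc]
    abel
  · change (Nᵀ * (Aᵀ * Q) * N + eᵀ * Q * N - Nᵀ * (Qᵀ * e)) * A = f ^ 2 • Q
    have h0 : Nᵀ * (Qᵀ * e) * A = 0 := by
      rw [Matrix.mul_assoc, Matrix.mul_assoc, he]
      simp
    rw [Matrix.sub_mul, Matrix.add_mul, h0, Matrix.mul_assoc _ N A, Matrix.mul_assoc _ N A, hN, heT]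
    simp [Matrix.sub_mul, Matrix.mul_assoc, smul_sub, smul_smul, pow_two]

lemma exact_skewMul_symMul (hf : f ∈ maxMinors A) (hg : g ∈ maxMinors A)
    (hfg : IsRegularPair f g) (h2 : (2 : R) ≠ 0) : Function.Exact (skewMul A) (symMul A) := by
  intro Q
  constructor
  · intro hQ
    obtain ⟨C, hC⟩ := exists_sq_smul_eq_skewMul hQ hf
    obtain ⟨D, hD⟩ := exists_sq_smul_eq_skewMul hQ hg
    have hCD : g ^ 2 • C = f ^ 2 • D := by
      refine skewMul_injective h2 hf hg hfg ?_
      rw [map_smul, map_smul, hC, hD, smul_comm]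
    have hCD' : ∀ i j, g ^ 2 * C.1 i j = f ^ 2 * D.1 i j := fun i j =>
      congrFun (congrFun (congrArg Subtype.val hCD) i) j
    choose C' hC' using fun i j => hfg.sq.2 _ _ (hCD' i j)
    have hf2 := hfg.sq.1
    have hskew : (Matrix.of C')ᵀ = -Matrix.of C' := by
      ext i j
      have := congrFun (congrFun C.2 i) j
      simp only [Matrix.transpose_apply, Matrix.neg_apply, Matrix.of_apply, hC'] at this ⊢
      exact mul_left_cancel₀ hf2 (by linear_combination this)
    refine ⟨⟨Matrix.of C', hskew⟩, smul_right_injective _ hf2 ?_⟩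
    simp only
    rw [← hC, ← map_smul]
    congr 1
    ext i j
    exact (hC' i j).symm
  · rintro ⟨C, rfl⟩
    change Aᵀ * (C.1 * A) + (C.1 * A)ᵀ * A = 0
    rw [Matrix.transpose_mul, show C.1ᵀ = -C.1 from C.2]
    simp [Matrix.mul_assoc]

end SymmetricSquare

section Cokernels

variable {R : Type} [CommRing R] [IsDomain R] {t : ℕ} {A : Matrix (Fin (t + 1)) (Fin t) R}
  {f g : R} {J : Ideal R}

lemma ExtVanishes.coker_transpose (hf : f ∈ maxMinors A) (hg : g ∈ maxMinors A)
    (hfg : IsRegularPair f g) (h : ExtVanishes J R 4) :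
    ExtVanishes J ((Fin t → R) ⧸ LinearMap.range Aᵀ.mulVecLin) 2 := by
  refine ExtVanishes.coker (f := LinearMap.toSpanSingleton R _ (signedMinor A)) ?_ ?_ h
    (h.mono (by omega)).pi (h.mono (by omega)).pi
  · rw [injective_iff_map_eq_zero]
    intro s hs
    obtain ⟨i, hi⟩ := exists_signedMinor_ne_zero hf hfg.1
    have : s * signedMinor A i = 0 := congrFun hs i
    exact (mul_eq_zero.1 this).resolve_right hi
  · intro u
    constructor
    · intro hu
      obtain ⟨s, hs⟩ := exists_eq_smul_signedMinor hf hg hfg hu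
      exact ⟨s, hs.symm⟩
    · rintro ⟨s, rfl⟩
      change Aᵀ *ᵥ (s • signedMinor A) = 0
      rw [Matrix.mulVec_smul, transpose_mulVec_signedMinor, smul_zero]

lemma ExtVanishes.coker_symMul [Invertible (2 : R)] (hf : f ∈ maxMinors A) (hg : g ∈ maxMinors A)
    (hfg : IsRegularPair f g) (h : ExtVanishes J R 4) :
    ExtVanishes J (Matrix (Fin t) (Fin t) R ⧸ LinearMap.range (symMul A)) 1 := by
  have h2 : (2 : R) ≠ 0 := Invertible.ne_zero 2
  exact ExtVanishes.coker (skewMul_injective h2 hf hg hfg) (exact_skewMul_symMul hf hg hfg h2)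
    (h.mono (by omega)).skewMatrices ((h.mono (by omega)).pi (ι := Fin t)).pi
    ((h.mono (by omega)).pi (ι := Fin t)).pi

end Cokernels

section SymmetricProduct

variable {R M N : Type} [CommRing R] [AddCommGroup M] [Module R M] [AddCommGroup N] [Module R N]

/-- The product `M × M → S₂M`. -/
def symProd : M →ₗ[R] M →ₗ[R] SymPow R M 2 :=
  LinearMap.mk₂ R (fun x y => Submodule.Quotient.mk (PiTensorProduct.tprod R ![x, y]))
    (fun x x' y => by
      have h := (PiTensorProduct.tprod R (s := fun _ : Fin 2 => M)).map_update_add ![x, y] 0 x x'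
      have e : ∀ z, Function.update ![x, y] 0 z = ![z, y] := fun z => by ext i; fin_cases i <;> rfl
      rw [e, e, e] at h
      rw [← Submodule.Quotient.mk_add, ← h])
    (fun c x y => by
      have h := (PiTensorProduct.tprod R (s := fun _ : Fin 2 => M)).map_update_smul ![x, y] 0 c x
      have e : ∀ z, Function.update ![x, y] 0 z = ![z, y] := fun z => by ext i; fin_cases i <;> rfl
      rw [e, e] at h
      rw [← Submodule.Quotient.mk_smul, ← h])
    (fun x y y' => by
      have h := (PiTensorProduct.tprod R (s := fun _ : Fin 2 => M)).map_update_add ![x, y] 1 y y'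
      have e : ∀ z, Function.update ![x, y] 1 z = ![x, z] := fun z => by ext i; fin_cases i <;> rfl
      rw [e, e, e] at h
      rw [← Submodule.Quotient.mk_add, ← h])
    (fun c x y => by
      have h := (PiTensorProduct.tprod R (s := fun _ : Fin 2 => M)).map_update_smul ![x, y] 1 c y
      have e : ∀ z, Function.update ![x, y] 1 z = ![x, z] := fun z => by ext i; fin_cases i <;> rfl
      rw [e, e] at h
      rw [← Submodule.Quotient.mk_smul, ← h])

lemma symProd_apply (x y : M) :
    symProd x y = (Submodule.Quotient.mk (PiTensorProduct.tprod R ![x, y]) : SymPow R M 2) := rfl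

lemma symProd_comm (x y : M) : (symProd x y : SymPow R M 2) = symProd y x := by
  rw [symProd_apply, symProd_apply, Submodule.Quotient.eq]
  refine Submodule.subset_span ⟨Equiv.swap 0 1, ![x, y], ?_⟩
  congr 2
  ext i
  fin_cases i <;> rfl

lemma span_symProd :
    Submodule.span R (Set.range fun p : M × M => (symProd p.1 p.2 : SymPow R M 2)) = ⊤ := by
  have h := PiTensorProduct.span_tprod_eq_top (R := R) (s := fun _ : Fin 2 => M)
  have h' := congrArg (Submodule.map (Submodule.mkQ (Submodule.span R
    {z : ⨂[R]^2 M | ∃ (σ : Equiv.Perm (Fin 2)) (f : Fin 2 → M),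
      z = PiTensorProduct.tprod R f - PiTensorProduct.tprod R (f ∘ σ)}))) h
  rw [Submodule.map_top, Submodule.range_mkQ, Submodule.map_span] at h'
  rw [← h']
  congr 1
  ext z
  constructor
  · rintro ⟨⟨x, y⟩, rfl⟩
    exact ⟨_, ⟨![x, y], rfl⟩, rfl⟩
  · rintro ⟨_, ⟨f, rfl⟩, rfl⟩
    refine ⟨(f 0, f 1), ?_⟩
    change Submodule.Quotient.mk _ = Submodule.Quotient.mk _
    congr 2
    ext i
    fin_cases i <;> rfl

/-- A bilinear map as a multilinear map in two variables. -/
def multilinearOfBilinear (B : M →ₗ[R] M →ₗ[R] N) : MultilinearMap R (fun _ : Fin 2 => M) N where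
  toFun v := B (v 0) (v 1)
  map_update_add' := by
    intro _ v i x y
    fin_cases i <;> simp
  map_update_smul' := by
    intro _ v i c x
    fin_cases i <;> simp

/-- The linear map on `S₂M` defined by a symmetric bilinear map. -/
def symLift (B : M →ₗ[R] M →ₗ[R] N) (hB : ∀ x y, B x y = B y x) : SymPow R M 2 →ₗ[R] N :=
  Submodule.liftQ _ (PiTensorProduct.lift (multilinearOfBilinear B)) (by
    rw [Submodule.span_le]
    rintro z ⟨σ, f, rfl⟩
    simp only [SetLike.mem_coe, LinearMap.mem_ker, map_sub, PiTensorProduct.lift.tprod,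
      multilinearOfBilinear, MultilinearMap.coe_mk, Function.comp_apply, sub_eq_zero]
    have h : σ 0 ≠ σ 1 := fun h => by simpa using σ.injective h
    generalize σ 0 = p at h ⊢
    generalize σ 1 = q at h ⊢
    fin_cases p <;> fin_cases q <;> first | rfl | exact hB _ _ | exact absurd rfl h)

lemma symLift_symProd (B : M →ₗ[R] M →ₗ[R] N) (hB : ∀ x y, B x y = B y x) (x y : M) :
    symLift B hB (symProd x y) = B x y :=
  PiTensorProduct.lift.tprod (φ := multilinearOfBilinear B) ![x, y]

end SymmetricProduct

section Torsion

variable {R N : Type} [CommRing R] [AddCommGroup N] [Module R N] {J : Ideal R}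

/-- No nonzero element of `N` is annihilated by `J`. -/
def TorsionFreeAt (J : Ideal R) (N : Type) [AddCommGroup N] [Module R N] : Prop :=
  ∀ x : N, (∀ r ∈ J, r • x = 0) → x = 0

lemma TorsionFreeAt.eq_zero_of_pow_le (hN : TorsionFreeAt J N) (m : ℕ) :
    ∀ x : N, (∀ r ∈ J ^ m, r • x = 0) → x = 0 := by
  induction m with
  | zero => exact fun x hx => by simpa using hx 1 (by simp)
  | succ m ih =>
    refine fun x hx => hN x fun r hr => ih _ fun s hs => ?_
    rw [smul_smul]
    exact hx _ (by rw [pow_succ]; exact Ideal.mul_mem_mul hs hr)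

lemma TorsionFreeAt.eq_zero_of_sq_smul (hN : TorsionFreeAt J N) (hJ : J.FG) {G : Set R}
    (hG : J = Ideal.span G) {x : N} (hx : ∀ δ ∈ G, (δ * δ) • x = 0) : x = 0 := by
  have hle : J ≤ (Ideal.torsionOf R N x).radical := by
    rw [hG, Ideal.span_le]
    exact fun δ hδ => ⟨2, by rw [pow_two]; exact hx δ hδ⟩
  obtain ⟨m, hm⟩ := Ideal.exists_pow_le_of_le_radical_of_fg hle hJ
  exact hN.eq_zero_of_pow_le m x fun r hr => hm hr

end Torsion

section CokernelOfTranspose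

variable {R N : Type} [CommRing R] [AddCommGroup N] [Module R N] {t : ℕ}
  {A : Matrix (Fin (t + 1)) (Fin t) R}

/-- The cokernel of the transpose of `A`. -/
abbrev CokT (A : Matrix (Fin (t + 1)) (Fin t) R) : Type :=
  (Fin t → R) ⧸ LinearMap.range Aᵀ.mulVecLin

/-- The projection onto the cokernel of the transpose of `A`. -/
def cokMk (A : Matrix (Fin (t + 1)) (Fin t) R) : (Fin t → R) →ₗ[R] CokT A := Submodule.mkQ _

lemma cokMk_surjective : Function.Surjective (cokMk A) := Submodule.mkQ_surjective _

lemma cokMk_eq_zero {v : Fin t → R} : cokMk A v = 0 ↔ ∃ u, Aᵀ *ᵥ u = v :=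
  Submodule.Quotient.mk_eq_zero _

lemma cokMk_row (j : Fin (t + 1)) : cokMk A (A j) = 0 := by
  refine cokMk_eq_zero.2 ⟨Pi.single j 1, ?_⟩
  rw [Matrix.mulVec_single_one]
  rfl

lemma cokMk_eq_sum (v : Fin t → R) : cokMk A v = ∑ i, v i • cokMk A (Pi.single i 1) := by
  rw [← Finset.univ_sum_single v, map_sum]
  refine Finset.sum_congr rfl fun i _ => ?_
  rw [← map_smul, ← Pi.single_smul, smul_eq_mul, mul_one, Finset.univ_sum_single]

lemma smul_cokMk_of_mem {f : R} (hf : f ∈ maxMinors A) (m : CokT A) : f • m = 0 := by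
  obtain ⟨v, rfl⟩ := cokMk_surjective m
  obtain ⟨N, hN⟩ := exists_mul_eq_smul_one A hf
  rw [← map_smul]
  refine cokMk_eq_zero.2 ⟨Nᵀ *ᵥ v, ?_⟩
  rw [Matrix.mulVec_mulVec, ← Matrix.transpose_mul, hN]
  simp [Matrix.smul_mulVec]

/-- A linear map vanishing on the rows of `A` descends to the cokernel. -/
def cokLift (h : (Fin t → R) →ₗ[R] N) (hA : ∀ j, h (A j) = 0) : CokT A →ₗ[R] N :=
  Submodule.liftQ _ h (by
    rintro _ ⟨u, rfl⟩
    rw [LinearMap.mem_ker, Matrix.mulVecLin_apply, Matrix.mulVec_eq_sum, map_sum]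
    refine Finset.sum_eq_zero fun j _ => ?_
    change h (MulOpposite.op (u j) • A j) = 0
    rw [op_smul_eq_smul, map_smul, hA, smul_zero])

@[simp] lemma cokLift_cokMk (h : (Fin t → R) →ₗ[R] N) (hA : ∀ j, h (A j) = 0) (v : Fin t → R) :
    cokLift h hA (cokMk A v) = h v := rfl

/-- The bilinear map on the cokernel induced by a symmetric bilinear map vanishing on rows. -/
def cokLift₂ (B : (Fin t → R) →ₗ[R] (Fin t → R) →ₗ[R] N) (hB : ∀ j v, B (A j) v = 0)
    (hB' : ∀ j v, B v (A j) = 0) : CokT A →ₗ[R] CokT A →ₗ[R] N :=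
  cokLift (cokLift B fun j => LinearMap.ext (hB j)).flip fun j => by
    refine LinearMap.ext fun x => ?_
    obtain ⟨v, rfl⟩ := cokMk_surjective x
    exact hB' j v

lemma cokLift₂_cokMk (B : (Fin t → R) →ₗ[R] (Fin t → R) →ₗ[R] N) (hB : ∀ j v, B (A j) v = 0)
    (hB' : ∀ j v, B v (A j) = 0) (v w : Fin t → R) :
    cokLift₂ B hB hB' (cokMk A v) (cokMk A w) = B w v := rfl

lemma symProd_induction {p : SymPow R (CokT A) 2 → Prop}
    (hp : ∀ v w, p (symProd (cokMk A v) (cokMk A w))) (h0 : p 0)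
    (hadd : ∀ x y, p x → p y → p (x + y)) (hsmul : ∀ (c : R) x, p x → p (c • x))
    (s : SymPow R (CokT A) 2) : p s := by
  have hs : s ∈ Submodule.span R (Set.range fun q : CokT A × CokT A =>
      (symProd q.1 q.2 : SymPow R (CokT A) 2)) := by
    rw [span_symProd]
    trivial
  induction hs using Submodule.span_induction with
  | mem x h =>
    obtain ⟨⟨x, y⟩, rfl⟩ := h
    obtain ⟨v, rfl⟩ := cokMk_surjective x
    obtain ⟨w, rfl⟩ := cokMk_surjective y
    exact hp v w
  | zero => exact h0
  | add x y _ _ hx hy => exact hadd x y hx hy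
  | smul c x _ hx => exact hsmul c x hx

end CokernelOfTranspose

section MatrixModel

variable {R : Type} [CommRing R] {t : ℕ} (A : Matrix (Fin (t + 1)) (Fin t) R)

/-- The quadratic form with coefficient matrix `X`, as an element of `S₂M`. -/
def quadForm : Matrix (Fin t) (Fin t) R →ₗ[R] SymPow R (CokT A) 2 :=
  ∑ a, (symProd (cokMk A (Pi.single a 1))) ∘ₗ cokMk A ∘ₗ
    (LinearMap.proj a : (Fin t → Fin t → R) →ₗ[R] (Fin t → R))

lemma quadForm_apply (X : Matrix (Fin t) (Fin t) R) :
    quadForm A X = ∑ a, symProd (cokMk A (Pi.single a 1)) (cokMk A (X a)) := by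
  simp [quadForm]
  rfl

lemma quadForm_vecMulVec (v w : Fin t → R) :
    quadForm A (vecMulVec v w) = symProd (cokMk A v) (cokMk A w) := by
  rw [quadForm_apply, cokMk_eq_sum v, map_sum, LinearMap.sum_apply]
  refine Finset.sum_congr rfl fun a _ => ?_
  rw [show vecMulVec v w a = v a • w from rfl, map_smul, map_smul, map_smul, LinearMap.smul_apply]

lemma eq_sum_vecMulVec (X : Matrix (Fin t) (Fin t) R) :
    X = ∑ a, vecMulVec (Pi.single a 1) (X a) := by
  ext i j
  rw [Matrix.sum_apply, Finset.sum_eq_single i]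
  · simp [vecMulVec_apply]
  · intro b _ hb
    simp [vecMulVec_apply, hb.symm]
  · simp

lemma quadForm_transpose (X : Matrix (Fin t) (Fin t) R) : quadForm A Xᵀ = quadForm A X := by
  rw [eq_sum_vecMulVec X, Matrix.transpose_sum, map_sum, map_sum]
  refine Finset.sum_congr rfl fun a _ => ?_
  rw [transpose_vecMulVec, quadForm_vecMulVec, quadForm_vecMulVec, symProd_comm]

lemma quadForm_surjective : Function.Surjective (quadForm A) := by
  refine symProd_induction (fun v w => ⟨_, quadForm_vecMulVec A v w⟩) ⟨0, map_zero _⟩ ?_ ?_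
  · rintro _ _ ⟨X, rfl⟩ ⟨Y, rfl⟩
    exact ⟨X + Y, map_add _ _ _⟩
  · rintro c _ ⟨X, rfl⟩
    exact ⟨c • X, map_smul _ _ _⟩

lemma transpose_mul_eq_sum (P Q : Matrix (Fin (t + 1)) (Fin t) R) :
    Pᵀ * Q = ∑ j, vecMulVec (P j) (Q j) := by
  ext a b
  simp [Matrix.mul_apply, Matrix.sum_apply, vecMulVec_apply]

lemma quadForm_symMul (Q : Matrix (Fin (t + 1)) (Fin t) R) : quadForm A (symMul A Q) = 0 := by
  have h : quadForm A (Aᵀ * Q) = 0 := by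
    rw [transpose_mul_eq_sum, map_sum]
    refine Finset.sum_eq_zero fun j _ => ?_
    rw [quadForm_vecMulVec, cokMk_row, map_zero, LinearMap.zero_apply]
  have h' : quadForm A (Qᵀ * A) = 0 := by
    rw [← quadForm_transpose, Matrix.transpose_mul, Matrix.transpose_transpose, h]
  change quadForm A (Aᵀ * Q + Qᵀ * A) = 0
  rw [map_add, h, h', add_zero]

/-- The bilinear map `(v, w) ↦ v wᵀ + w vᵀ`. -/
def symOuter : (Fin t → R) →ₗ[R] (Fin t → R) →ₗ[R] Matrix (Fin t) (Fin t) R :=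
  LinearMap.mk₂ R (fun v w => vecMulVec v w + vecMulVec w v)
    (fun v v' w => by rw [add_vecMulVec, vecMulVec_add]; abel)
    (fun c v w => by rw [smul_vecMulVec, vecMulVec_smul, smul_add])
    (fun v w w' => by rw [add_vecMulVec, vecMulVec_add]; abel)
    (fun c v w => by rw [smul_vecMulVec, vecMulVec_smul, smul_add])

lemma symOuter_apply (v w : Fin t → R) :
    symOuter v w = vecMulVec v w + vecMulVec w v := rfl

lemma symOuter_comm (v w : Fin t → R) : symOuter v w = symOuter w v := add_comm _ _

lemma symOuter_row_mem (j : Fin (t + 1)) (w : Fin t → R) :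
    symOuter (A j) w ∈ LinearMap.range (symMul A) := by
  refine ⟨vecMulVec (Pi.single j 1) w, ?_⟩
  have h : Aᵀ * vecMulVec (Pi.single j 1) w = vecMulVec (A j) w := by
    rw [mul_vecMulVec, Matrix.mulVec_single_one]
    rfl
  change Aᵀ * vecMulVec (Pi.single j 1) w + (vecMulVec (Pi.single j 1) w)ᵀ * A = _
  rw [h, symOuter_apply]
  congr 1
  rw [← transpose_vecMulVec (A j), ← h, Matrix.transpose_mul, Matrix.transpose_transpose]

/-- The class of `v wᵀ + w vᵀ` modulo the matrices `Aᵀ Q + Qᵀ A`. -/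
def symOuterMk : (Fin t → R) →ₗ[R] (Fin t → R) →ₗ[R]
    Matrix (Fin t) (Fin t) R ⧸ LinearMap.range (symMul A) :=
  symOuter.compr₂ (Submodule.mkQ _)

lemma symOuterMk_apply (v w : Fin t → R) :
    symOuterMk A v w = Submodule.Quotient.mk (vecMulVec v w + vecMulVec w v) := rfl

lemma symOuterMk_comm (v w : Fin t → R) : symOuterMk A v w = symOuterMk A w v :=
  congrArg Submodule.Quotient.mk (symOuter_comm v w)

lemma symOuterMk_row (j : Fin (t + 1)) (w : Fin t → R) : symOuterMk A (A j) w = 0 :=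
  (Submodule.Quotient.mk_eq_zero _).2 (symOuter_row_mem A j w)

/-- Polarisation `S₂M → Mat / {Aᵀ Q + Qᵀ A}`. -/
def polarization :
    SymPow R (CokT A) 2 →ₗ[R] Matrix (Fin t) (Fin t) R ⧸ LinearMap.range (symMul A) :=
  symLift (cokLift₂ (symOuterMk A) (symOuterMk_row A)
    (fun j v => (symOuterMk_comm A _ _).trans (symOuterMk_row A j v))) (fun x y => by
    obtain ⟨v, rfl⟩ := cokMk_surjective x
    obtain ⟨w, rfl⟩ := cokMk_surjective y
    rw [cokLift₂_cokMk, cokLift₂_cokMk, symOuterMk_comm])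

lemma polarization_symProd (v w : Fin t → R) : polarization A (symProd (cokMk A v) (cokMk A w)) =
    Submodule.Quotient.mk (vecMulVec v w + vecMulVec w v) := by
  rw [polarization, symLift_symProd, cokLift₂_cokMk, symOuterMk_comm, symOuterMk_apply]

lemma polarization_quadForm (X : Matrix (Fin t) (Fin t) R) :
    polarization A (quadForm A X) = Submodule.Quotient.mk (X + Xᵀ) := by
  rw [quadForm_apply, map_sum]
  simp only [polarization_symProd]
  change ∑ a, Submodule.mkQ _ _ = Submodule.mkQ _ _
  rw [← map_sum, Finset.sum_add_distrib, ← eq_sum_vecMulVec]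
  congr 2
  conv_rhs => rw [eq_sum_vecMulVec X, Matrix.transpose_sum]
  simp only [transpose_vecMulVec]

lemma torsionFreeAt_symPow [Invertible (2 : R)] {J : Ideal R}
    (h : ExtVanishes J (Matrix (Fin t) (Fin t) R ⧸ LinearMap.range (symMul A)) 1) :
    TorsionFreeAt J (SymPow R (CokT A) 2) := by
  intro s hs
  obtain ⟨X, rfl⟩ := quadForm_surjective A s
  have h0 : polarization A (quadForm A X) = 0 :=
    h.eq_zero_of_smul_eq_zero fun r hr => by rw [← map_smul, hs r hr, map_zero]
  rw [polarization_quadForm, Submodule.Quotient.mk_eq_zero] at h0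
  obtain ⟨Q, hQ⟩ := h0
  have h1 : quadForm A X + quadForm A X = 0 := by
    rw [← quadForm_symMul A Q, hQ, map_add, quadForm_transpose]
  have h2 : (2 : R) • quadForm A X = 0 := by rw [two_smul, h1]
  rw [← one_smul R (quadForm A X), ← invOf_mul_self (2 : R), mul_smul, h2, smul_zero]

end MatrixModel

section BorderedMinor

variable {R : Type} [CommRing R] {s : ℕ} (A : Matrix (Fin (s + 2)) (Fin (s + 1)) R)

/-- The determinant of the matrix with first row `v` and remaining rows `A (r k)`,
as a linear form in `v`. -/
def borderedMinor (r : Fin s → Fin (s + 2)) : (Fin (s + 1) → R) →ₗ[R] R :=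
  (Matrix.detRowAlternating (R := R) (n := Fin (s + 1))).toMultilinearMap.toLinearMap
    (Fin.cons 0 fun k => A (r k)) 0

lemma borderedMinor_apply (r : Fin s → Fin (s + 2)) (v : Fin (s + 1) → R) :
    borderedMinor A r v =
      (Matrix.of (Fin.cons v fun k => A (r k) : Fin (s + 1) → Fin (s + 1) → R)).det := by
  change Matrix.detRowAlternating (Function.update (Fin.cons 0 fun k => A (r k)) 0 v) = _
  rw [Fin.update_cons_zero]
  rfl

lemma borderedMinor_row_mem (r : Fin s → Fin (s + 2)) (hr : Function.Injective r)
    (j : Fin (s + 2)) : borderedMinor A r (A j) ∈ maxMinors A := by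
  rw [borderedMinor_apply]
  by_cases hj : j ∈ Set.range r
  · obtain ⟨k, rfl⟩ := hj
    rw [Matrix.det_zero_of_row_eq (Fin.succ_ne_zero k).symm (by rfl)]
    exact zero_mem _
  · have h : (Matrix.of (Fin.cons (A j) fun k => A (r k) : Fin (s + 1) → Fin (s + 1) → R)) =
        A.submatrix (Fin.cons j r : Fin (s + 1) → Fin (s + 2)) id := by
      ext a b
      refine Fin.cases ?_ (fun k => ?_) a <;> rfl
    rw [h]
    exact det_submatrix_mem_maxMinors A _ _ (Fin.cons_injective_iff.2 ⟨hj, hr⟩)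
      Function.injective_id

lemma exists_borderedMinor_eq (r : Fin s → Fin (s + 2)) (c : Fin s → Fin (s + 1))
    (hc : Function.Injective c) : ∃ u, borderedMinor A r u = (A.submatrix r c).det := by
  obtain ⟨c₀, hc₀⟩ : ∃ j, j ∉ Set.range c := by
    by_contra! hcon
    have := Fintype.card_le_of_surjective c hcon
    simp at this
  let σ : Equiv.Perm (Fin (s + 1)) := Equiv.ofBijective (Fin.cons c₀ c : Fin (s + 1) → Fin (s + 1))
    (Finite.injective_iff_bijective.1 (Fin.cons_injective_iff.2 ⟨hc₀, hc⟩))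
  have hσ0 : σ 0 = c₀ := rfl
  have hσs : ∀ k, σ (Fin.succ k) = c k := fun k => rfl
  let B : Matrix (Fin (s + 1)) (Fin (s + 1)) R :=
    Matrix.of (Fin.cons (Pi.single c₀ 1) fun k => A (r k))
  have hB : (B.submatrix id σ).det = (A.submatrix r c).det := by
    rw [Matrix.det_succ_row_zero, Finset.sum_eq_single 0]
    · have h1 : B.submatrix id σ 0 0 = 1 := by simp [B, hσ0]
      have h2 : (B.submatrix id σ).submatrix Fin.succ (Fin.succAbove 0) = A.submatrix r c := by
        ext a b
        simp [B, hσs]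
      rw [h1, h2]
      simp
    · intro j _ hj
      have : B.submatrix id σ 0 j = 0 := by
        have : σ j ≠ c₀ := fun h => hj (σ.injective (h.trans hσ0.symm))
        simp [B, this]
      rw [this]
      simp
    · simp
  refine ⟨((Equiv.Perm.sign σ : ℤ) : R) • Pi.single c₀ 1, ?_⟩
  rw [map_smul, borderedMinor_apply, smul_eq_mul, ← hB, Matrix.det_permute']

lemma borderedMinor_smul_comm (r : Fin s → Fin (s + 2)) (v w : Fin (s + 1) → R) :
    borderedMinor A r v • cokMk A w = borderedMinor A r w • cokMk A v := by
  let B : Matrix (Fin (s + 2)) (Fin (s + 1)) R :=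
    Matrix.of (Fin.cons v (Fin.cons w fun k => A (r k) : Fin (s + 1) → Fin (s + 1) → R))
  have h := transpose_mulVec_signedMinor B
  have h0 : signedMinor B 0 = borderedMinor A r w := by
    rw [borderedMinor_apply, signedMinor]
    simp only [Fin.val_zero, pow_zero, one_mul]
    congr 1
  have h1 : signedMinor B 1 = -borderedMinor A r v := by
    rw [borderedMinor_apply, signedMinor]
    simp only [Fin.val_one, pow_one, neg_mul, one_mul]
    congr 2
    ext a b
    refine Fin.cases ?_ (fun k => ?_) a
    · rfl
    · simp [B]
  rw [Matrix.mulVec_eq_sum, Fin.sum_univ_succ, Fin.sum_univ_succ] at h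
  have h' := congrArg (cokMk A) h
  rw [map_add, map_add, map_sum, map_zero, Finset.sum_eq_zero, add_zero, op_smul_eq_smul,
    op_smul_eq_smul, map_smul, map_smul, h0] at h'
  · change _ + signedMinor B 1 • cokMk A w = 0 at h'
    rw [h1, neg_smul, ← sub_eq_add_neg, sub_eq_zero] at h'
    exact h'.symm
  · intro k _
    rw [op_smul_eq_smul, map_smul]
    change _ • cokMk A (A (r k)) = 0
    rw [cokMk_row, smul_zero]

end BorderedMinor

section Quotient

variable {R M N : Type} [CommRing R] [AddCommGroup M] [Module R M] [AddCommGroup N] [Module R N]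
  {J : Ideal R}

lemma TorsionFreeAt.linearMap (h : TorsionFreeAt J N) : TorsionFreeAt J (M →ₗ[R] N) :=
  fun _ hf => LinearMap.ext fun x => h _ fun r hr => LinearMap.congr_fun (hf r hr) x

lemma TorsionFreeAt.quotient_range (hN : TorsionFreeAt J N) (hM : ExtVanishes J M 2)
    (g : M →ₗ[R] N) (hg : Function.Injective g) : TorsionFreeAt J (N ⧸ LinearMap.range g) := by
  intro x hx
  obtain ⟨f, rfl⟩ := Submodule.mkQ_surjective _ x
  let e := LinearEquiv.ofInjective g hg
  have hf : ∀ r ∈ J, r • f ∈ LinearMap.range g :=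
    fun r hr => (Submodule.Quotient.mk_eq_zero _).1 (hx r hr)
  let ψ : J →ₗ[R] M := e.symm.toLinearMap ∘ₗ
    ((LinearMap.toSpanSingleton R _ f).comp J.subtype).codRestrict _ fun r => hf r r.2
  have hψ : ∀ r : J, g (ψ r) = (r : R) • f := fun r =>
    congrArg Subtype.val (e.apply_symm_apply ⟨(r : R) • f, hf r r.2⟩)
  obtain ⟨m, hm⟩ := hM.exists_eq_smul ψ
  refine (Submodule.Quotient.mk_eq_zero _).2 ⟨m, (sub_eq_zero.1 (hN _ fun r hr => ?_)).symm⟩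
  rw [smul_sub, sub_eq_zero, ← map_smul, ← hψ ⟨r, hr⟩, hm]

lemma TorsionFreeAt.exists_eq_of_sq_smul (hN : TorsionFreeAt J N) (hM : ExtVanishes J M 2)
    {g : M →ₗ[R] N} (hg : Function.Injective g) (hJ : J.FG) {G : Set R} (hG : J = Ideal.span G)
    {f : N} (h : ∀ δ ∈ G, ∃ m, (δ * δ) • f = g m) : ∃ m, f = g m := by
  have h0 := (hN.quotient_range hM g hg).eq_zero_of_sq_smul hJ hG (x := Submodule.mkQ _ f)
    fun δ hδ => by
      obtain ⟨m, hm⟩ := h δ hδ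
      rw [← map_smul, hm]
      exact (Submodule.Quotient.mk_eq_zero _).2 ⟨m, rfl⟩
  obtain ⟨m, hm⟩ := (Submodule.Quotient.mk_eq_zero _).1 h0
  exact ⟨m, hm.symm⟩

end Quotient

section Multiplication

variable {R : Type} [CommRing R] {t : ℕ} {A : Matrix (Fin (t + 1)) (Fin t) R}

/-- `δ` is a value of a linear form which induces a map `M → R/I` and whose values
are interchangeable with elements of `M`. -/
def IsBorderValue (A : Matrix (Fin (t + 1)) (Fin t) R) (δ : R) : Prop :=
  ∃ (D : (Fin t → R) →ₗ[R] R) (u : Fin t → R), D u = δ ∧ (∀ j, D (A j) ∈ maxMinors A) ∧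
    ∀ v w, D v • cokMk A w = D w • cokMk A v

/-- The linear form `M → R/I` induced by `D`. -/
def formMk (D : (Fin t → R) →ₗ[R] R) (hD : ∀ j, D (A j) ∈ maxMinors A) :
    CokT A →ₗ[R] R ⧸ maxMinors A :=
  cokLift (Submodule.mkQ (maxMinors A) ∘ₗ D) fun j => (Submodule.Quotient.mk_eq_zero _).2 (hD j)

lemma formMk_cokMk (D : (Fin t → R) →ₗ[R] R) (hD : ∀ j, D (A j) ∈ maxMinors A) (v : Fin t → R) :
    formMk D hD (cokMk A v) = Ideal.Quotient.mk _ (D v) := rfl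

lemma mul_mem_of_symProd_eq_zero (D : (Fin t → R) →ₗ[R] R) (hD : ∀ j, D (A j) ∈ maxMinors A)
    {u v : Fin t → R} (h : (symProd (cokMk A u) (cokMk A v) : SymPow R (CokT A) 2) = 0) :
    D u * D v ∈ maxMinors A := by
  have h' := symLift_symProd ((LinearMap.mul R (R ⧸ maxMinors A)).compl₁₂ (formMk D hD) (formMk D hD))
    (fun x y => by simp [mul_comm]) (cokMk A u) (cokMk A v)
  rw [h, map_zero, LinearMap.compl₁₂_apply, formMk_cokMk, formMk_cokMk, LinearMap.mul_apply',
    ← map_mul] at h'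
  exact Ideal.Quotient.eq_zero_iff_mem.1 h'.symm

lemma IsBorderValue.sq_smul_eq_zero {δ : R} (h : IsBorderValue A δ) {x : CokT A}
    (hx : ∀ y, (symProd x y : SymPow R (CokT A) 2) = 0) : (δ * δ) • x = 0 := by
  obtain ⟨D, u, rfl, hD, hc⟩ := h
  obtain ⟨v, rfl⟩ := cokMk_surjective x
  rw [mul_smul, hc u v, smul_smul]
  refine smul_cokMk_of_mem (mul_mem_of_symProd_eq_zero D hD ?_) _
  rw [symProd_comm]
  exact hx _

lemma exists_smul_eq_symProd {D : (Fin t → R) →ₗ[R] R}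
    (hc : ∀ v w, D v • cokMk A w = D w • cokMk A v) (u : Fin t → R) (s : SymPow R (CokT A) 2) :
    ∃ m, D u • s = symProd (cokMk A u) m := by
  refine symProd_induction (p := fun s => ∃ m, D u • s = symProd (cokMk A u) m)
    (fun v w => ⟨D v • cokMk A w, ?_⟩) ⟨0, by simp⟩ ?_ ?_ s
  · rw [← LinearMap.smul_apply, ← map_smul, hc u v, map_smul, map_smul, LinearMap.smul_apply]
  · rintro x y ⟨m, hm⟩ ⟨m', hm'⟩
    exact ⟨m + m', by rw [smul_add, map_add, hm, hm']⟩
  · rintro c x ⟨m, hm⟩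
    exact ⟨c • m, by rw [smul_comm, map_smul, hm]⟩

lemma IsBorderValue.exists_sq_smul_eq {δ : R} (h : IsBorderValue A δ)
    (f : CokT A →ₗ[R] SymPow R (CokT A) 2) : ∃ m, (δ * δ) • f = symProd m := by
  obtain ⟨D, u, rfl, -, hc⟩ := h
  obtain ⟨m, hm⟩ := exists_smul_eq_symProd hc u (f (cokMk A u))
  refine ⟨D u • m, LinearMap.ext fun x => ?_⟩
  obtain ⟨v, rfl⟩ := cokMk_surjective x
  rw [LinearMap.smul_apply, mul_smul, ← map_smul f, hc u v, map_smul, smul_comm, hm,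
    symProd_comm, map_smul, LinearMap.smul_apply, ← map_smul (symProd m), ← map_smul (symProd m),
    ← hc u v]

variable {J : Ideal R} {G : Set R}

lemma symProd_injective (hM : TorsionFreeAt J (CokT A)) (hJ : J.FG) (hG : J = Ideal.span G)
    (hδ : ∀ δ ∈ G, IsBorderValue A δ) :
    Function.Injective (symProd : CokT A →ₗ[R] CokT A →ₗ[R] SymPow R (CokT A) 2) := by
  rw [injective_iff_map_eq_zero]
  exact fun x hx => hM.eq_zero_of_sq_smul hJ hG fun δ h =>
    (hδ δ h).sq_smul_eq_zero fun y => by rw [hx, LinearMap.zero_apply]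

lemma exists_eq_symProd (hM : ExtVanishes J (CokT A) 2) (hS : TorsionFreeAt J (SymPow R (CokT A) 2))
    (hJ : J.FG) (hG : J = Ideal.span G) (hδ : ∀ δ ∈ G, IsBorderValue A δ)
    (f : CokT A →ₗ[R] SymPow R (CokT A) 2) : ∃ m, f = symProd m := by
  have hinj := symProd_injective
    (fun x hx => (hM.mono one_le_two).eq_zero_of_smul_eq_zero hx) hJ hG hδ
  exact hS.linearMap.exists_eq_of_sq_smul hM hinj hJ hG fun δ h => (hδ δ h).exists_sq_smul_eq f

end Multiplication

section Complex

variable {R : Type} [CommRing R] {t : ℕ} (A : Matrix (Fin (t + 1)) (Fin t) R)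

/-- The identification `R^m ⊗ S = S^m`. -/
def piTensor (R S : Type) [CommRing R] [AddCommGroup S] [Module R S] (m : ℕ) :
    (Fin m → R) ⊗[R] S ≃ₗ[R] (Fin m → S) :=
  (TensorProduct.comm R _ _).trans (TensorProduct.piScalarRight R R S (Fin m))

lemma piTensor_tmul {S : Type} [AddCommGroup S] [Module R S] {m : ℕ} (v : Fin m → R) (s : S)
    (j : Fin m) : piTensor R S m (v ⊗ₜ s) j = v j • s := by
  simp [piTensor]

lemma piTensor_map {S : Type} [AddCommGroup S] [Module R S] (x : (Fin t → R) ⊗[R] S)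
    (j : Fin (t + 1)) : piTensor R S (t + 1) (TensorProduct.map A.mulVecLin LinearMap.id x) j =
      ∑ i, A j i • piTensor R S t x i := by
  induction x with
  | zero => simp
  | tmul v s =>
    simp only [TensorProduct.map_tmul, piTensor_tmul, LinearMap.id_apply, smul_smul,
      Matrix.mulVecLin_apply, Matrix.mulVec, dotProduct, Finset.sum_smul]
  | add x y hx hy => simp only [map_add, Pi.add_apply, hx, hy, smul_add, Finset.sum_add_distrib]

/-- The map `M → F ⊗ S₂M`, `m ↦ ∑ eᵢ ⊗ eᵢ* m`. -/
def coevalMul : CokT A →ₗ[R] (Fin t → R) ⊗[R] SymPow R (CokT A) 2 :=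
  (piTensor R _ t).symm.toLinearMap ∘ₗ
    LinearMap.pi fun i => (symProd : CokT A →ₗ[R] CokT A →ₗ[R] _) (cokMk A (Pi.single i 1))

lemma piTensor_coevalMul (m : CokT A) (i : Fin t) :
    piTensor R _ t (coevalMul A m) i = symProd (cokMk A (Pi.single i 1)) m := by
  rw [coevalMul, LinearMap.comp_apply, LinearEquiv.coe_coe, LinearEquiv.apply_symm_apply]
  rfl

variable {A}

lemma coevalMul_injective
    (h : Function.Injective (symProd : CokT A →ₗ[R] CokT A →ₗ[R] SymPow R (CokT A) 2)) :
    Function.Injective (coevalMul A) := by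
  rw [injective_iff_map_eq_zero]
  refine fun m hm => (injective_iff_map_eq_zero _).1 h m (LinearMap.ext fun x => ?_)
  obtain ⟨v, rfl⟩ := cokMk_surjective x
  rw [cokMk_eq_sum, map_sum]
  refine Finset.sum_eq_zero fun i _ => ?_
  rw [map_smul, symProd_comm, ← piTensor_coevalMul, hm, map_zero, Pi.zero_apply, smul_zero]

lemma exact_coevalMul (h : ∀ f : CokT A →ₗ[R] SymPow R (CokT A) 2, ∃ m, f = symProd m) :
    Function.Exact (coevalMul A) (TensorProduct.map A.mulVecLin
      (LinearMap.id : SymPow R (CokT A) 2 →ₗ[R] SymPow R (CokT A) 2)) := by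
  intro x
  constructor
  · intro hx
    let s := piTensor R _ t x
    obtain ⟨m, hm⟩ := h (cokLift (Fintype.linearCombination R s) fun j => by
      rw [Fintype.linearCombination_apply, ← piTensor_map, hx, map_zero, Pi.zero_apply])
    refine ⟨m, (piTensor R _ t).injective (funext fun i => ?_)⟩
    rw [piTensor_coevalMul, symProd_comm, ← hm, cokLift_cokMk,
      Fintype.linearCombination_apply_single, one_smul]
  · rintro ⟨m, rfl⟩
    refine (piTensor R _ (t + 1)).injective (funext fun j => ?_)
    rw [piTensor_map, map_zero, Pi.zero_apply]
    simp only [piTensor_coevalMul, symProd_comm _ m]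
    simp only [← map_smul]
    rw [← map_sum]
    simp only [map_smul]
    rw [← cokMk_eq_sum, cokMk_row, map_zero]

end Complex

section Depth

variable {R : Type} [CommRing R]

/-- Rees' theorem: depth at least `d` forces the vanishing of `Ext^i(R/J, N)` for `i < d`. -/
lemma ExtVanishes.of_depthGE [IsNoetherianRing R] {J I : Ideal R} {d : ℕ} (hIJ : I ≤ J)
    (h : depthGE J (R ⧸ I) d) : ExtVanishes J (R ⧸ I) d := by
  obtain ⟨rs, rfl, hrs, hreg⟩ := h
  by_cases hJ : J = ⊤
  · exact ExtVanishes.of_eq_top hJ _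
  refine ModuleCat.subsingleton_ext_of_exists_isRegular J (ModuleCat.of R (R ⧸ J)) ?_
    (ModuleCat.of R (R ⧸ I)) ?_ rs hrs hreg
  · change Module.support R (R ⧸ J) ⊆ _
    rw [Module.support_eq_zeroLocus, Ideal.annihilator_quotient]
  · rw [lt_top_iff_ne_top]
    intro htop
    apply hJ
    rw [Ideal.eq_top_iff_one]
    have h1 : (Submodule.Quotient.mk (1 : R) : R ⧸ I) ∈ J • (⊤ : Submodule R (R ⧸ I)) :=
      htop.symm ▸ Submodule.mem_top
    have h2 : J • (⊤ : Submodule R (R ⧸ I)) ≤ Submodule.map (Submodule.mkQ I) J := by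
      rw [Submodule.smul_le]
      intro r hr x _
      obtain ⟨y, rfl⟩ := Submodule.mkQ_surjective I x
      exact ⟨r * y, Ideal.mul_mem_right _ _ hr, rfl⟩
    obtain ⟨y, hy, hy1⟩ := h2 h1
    have h3 : y - 1 ∈ I := (Submodule.Quotient.eq I).1 hy1
    simpa using sub_mem hy (hIJ h3)

lemma depthGE.exists_isRegularPair [Nontrivial R] {I : Ideal R} (h : depthGE I R 2) :
    ∃ f ∈ I, ∃ g ∈ I, IsRegularPair f g := by
  obtain ⟨rs, hlen, hmem, hreg⟩ := h
  obtain ⟨f, g, rfl⟩ := List.length_eq_two.1 hlen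
  exact ⟨f, hmem f (by simp), g, hmem g (by simp), isRegularPair_of_isRegular hreg⟩

end Depth

section MinorForm

variable {R : Type} [CommRing R] {t : ℕ} (A : Matrix (Fin (t + 1)) (Fin t) R)

/-- The map `G → I`, pairing with the vector of signed maximal minors. -/
def minorForm : (Fin (t + 1) → R) →ₗ[R] maxMinors A :=
  (Fintype.linearCombination R (signedMinor A)).codRestrict (maxMinors A) fun u => by
    rw [Fintype.linearCombination_apply]
    exact Ideal.sum_mem _ fun i _ => Ideal.mul_mem_left _ _ (signedMinor_mem A i)

lemma minorForm_coe (u : Fin (t + 1) → R) : (minorForm A u : R) = signedMinor A ⬝ᵥ u := by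
  rw [dotProduct_comm]
  rfl

lemma minorForm_surjective : Function.Surjective (minorForm A) := by
  rintro ⟨x, hx⟩
  obtain ⟨u, hu⟩ := (Ideal.mem_span_range_iff_exists_fun).1 hx
  exact ⟨u, Subtype.ext hu⟩

variable {A} {f g : R}

lemma exact_minorForm [IsDomain R] (hf : f ∈ maxMinors A) (hg : g ∈ maxMinors A)
    (hfg : IsRegularPair f g) : Function.Exact A.mulVecLin (minorForm A) := by
  intro u
  rw [← Submodule.coe_eq_zero, minorForm_coe]
  constructor
  · intro hu
    exact exists_eq_mulVec hf hg hfg hu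
  · rintro ⟨v, rfl⟩
    rw [Matrix.mulVecLin_apply, Matrix.dotProduct_mulVec, ← Matrix.mulVec_transpose,
      transpose_mulVec_signedMinor, zero_dotProduct]

variable (A) in
/-- The map `G ⊗ S → S ⊗ I` induced by the signed maximal minors. -/
def minorTensor (S : Type) [AddCommGroup S] [Module R S] :
    (Fin (t + 1) → R) ⊗[R] S →ₗ[R] S ⊗[R] maxMinors A :=
  (TensorProduct.comm R _ _).toLinearMap ∘ₗ (minorForm A).rTensor S

lemma minorTensor_surjective (S : Type) [AddCommGroup S] [Module R S] :
    Function.Surjective (minorTensor A S) :=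
  (TensorProduct.comm R _ _).surjective.comp
    (LinearMap.rTensor_surjective S (minorForm_surjective A))

lemma exact_minorTensor [IsDomain R] (h : depthGE (maxMinors A) R 2) (S : Type) [AddCommGroup S]
    [Module R S] :
    Function.Exact (TensorProduct.map A.mulVecLin (LinearMap.id : S →ₗ[R] S)) (minorTensor A S) := by
  obtain ⟨f, hf, g, hg, hfg⟩ := h.exists_isRegularPair
  exact fun x => ((TensorProduct.comm R _ _).map_eq_zero_iff).trans
    (rTensor_exact S (exact_minorForm hf hg hfg) (minorForm_surjective A) x)

lemma extVanishes_self [IsDomain R] {J : Ideal R} (hf : f ∈ maxMinors A) (hg : g ∈ maxMinors A)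
    (hfg : IsRegularPair f g) (hIJ : maxMinors A ≤ J) {d : ℕ}
    (hB : ExtVanishes J (R ⧸ maxMinors A) d) : ExtVanishes J R d :=
  ExtVanishes.of_resolution A hIJ (det_submatrix_mem_maxMinors A)
    (mulVec_injective_of_mem_maxMinors hf hfg.1) (minorForm A) (minorForm_surjective A)
    (exact_minorForm hf hg hfg) hB

lemma injective_and_exact_coevalMul [IsDomain R] [Invertible (2 : R)] {J : Ideal R} {G : Set R}
    (hf : f ∈ maxMinors A) (hg : g ∈ maxMinors A) (hfg : IsRegularPair f g)
    (hR : ExtVanishes J R 4) (hJ : J.FG) (hG : J = Ideal.span G)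
    (hδ : ∀ δ ∈ G, IsBorderValue A δ) :
    Function.Injective (coevalMul A) ∧ Function.Exact (coevalMul A)
      (TensorProduct.map A.mulVecLin
        (LinearMap.id : SymPow R (CokT A) 2 →ₗ[R] SymPow R (CokT A) 2)) := by
  have hM : ExtVanishes J (CokT A) 2 := ExtVanishes.coker_transpose hf hg hfg hR
  have hS : TorsionFreeAt J (SymPow R (CokT A) 2) :=
    torsionFreeAt_symPow A (ExtVanishes.coker_symMul hf hg hfg hR)
  exact ⟨coevalMul_injective (symProd_injective
      (fun x hx => (hM.mono one_le_two).eq_zero_of_smul_eq_zero hx) hJ hG hδ),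
    exact_coevalMul (exists_eq_symProd hM hS hJ hG hδ)⟩

end MinorForm

section Minors

variable {k : Type} [Field k] {n : ℕ}

lemma minors_eq_maxMinors {t : ℕ} (A : Matrix (Fin (t + 1)) (Fin t) (RR k n)) :
    minors A t = maxMinors A := by
  apply le_antisymm
  · rw [minors, Ideal.span_le]
    rintro _ ⟨r, c, hr, hc, rfl⟩
    exact det_submatrix_mem_maxMinors A r c hr hc
  · rw [maxMinors, Ideal.span_le]
    rintro _ ⟨i, rfl⟩
    exact Ideal.mul_mem_left _ _ (Ideal.subset_span
      ⟨i.succAbove, id, Fin.succAbove_right_injective, Function.injective_id, rfl⟩)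

lemma minors_zero {p t : ℕ} (A : Matrix (Fin p) (Fin t) (RR k n)) : minors A 0 = ⊤ :=
  (Ideal.eq_top_iff_one _).2 (Ideal.subset_span
    ⟨Fin.elim0, Fin.elim0, Function.injective_of_subsingleton _,
      Function.injective_of_subsingleton _, Matrix.det_fin_zero.symm⟩)

instance invertibleTwo [CharZero k] : Invertible (2 : RR k n) :=
  ⟨MvPolynomial.C (2⁻¹), by
    rw [← map_ofNat MvPolynomial.C 2, ← map_mul, inv_mul_cancel₀ two_ne_zero, map_one], by
    rw [← map_ofNat MvPolynomial.C 2, ← map_mul, mul_inv_cancel₀ two_ne_zero, map_one]⟩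

lemma minors_succ_le {p t s : ℕ} (A : Matrix (Fin p) (Fin t) (RR k n)) :
    minors A (s + 1) ≤ minors A s := by
  rw [minors, Ideal.span_le]
  rintro _ ⟨r, c, hr, hc, rfl⟩
  rw [Matrix.det_succ_row_zero]
  refine Ideal.sum_mem _ fun j _ => Ideal.mul_mem_left _ _ (Ideal.subset_span
    ⟨r ∘ Fin.succ, c ∘ j.succAbove, hr.comp (Fin.succ_injective _),
      hc.comp Fin.succAbove_right_injective, rfl⟩)

lemma isBorderValue_minor {s : ℕ} (A : Matrix (Fin (s + 2)) (Fin (s + 1)) (RR k n))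
    {r : Fin s → Fin (s + 2)} {c : Fin s → Fin (s + 1)} (hr : Function.Injective r)
    (hc : Function.Injective c) : IsBorderValue A (A.submatrix r c).det := by
  obtain ⟨u, hu⟩ := exists_borderedMinor_eq A r c hc
  exact ⟨borderedMinor A r, u, hu, borderedMinor_row_mem A r hr, borderedMinor_smul_comm A r⟩

lemma injective_and_exact_of_depthGE [CharZero k] {s : ℕ}
    {A : Matrix (Fin (s + 2)) (Fin (s + 1)) (RR k n)}
    (hdet : depthGE (maxMinors A) (RR k n) 2)
    (hdepth : depthGE (minors A s) (RR k n ⧸ maxMinors A) 4) :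
    Function.Injective (coevalMul A) ∧ Function.Exact (coevalMul A)
      (TensorProduct.map A.mulVecLin (LinearMap.id :
        SymPow (RR k n) (CokT A) 2 →ₗ[RR k n] SymPow (RR k n) (CokT A) 2)) := by
  obtain ⟨f, hf, g, hg, hfg⟩ := hdet.exists_isRegularPair
  have hIJ : maxMinors A ≤ minors A s := (minors_eq_maxMinors A).symm.trans_le (minors_succ_le A)
  have hJ : (minors A s).FG := IsNoetherian.noetherian _
  exact injective_and_exact_coevalMul hf hg hfg
    (extVanishes_self hf hg hfg hIJ (ExtVanishes.of_depthGE hIJ hdepth)) hJ rfl (by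
      rintro _ ⟨r, c, hr, hc, rfl⟩
      exact isBorderValue_minor A hr hc)

end Minors

/-- exact sequence `crellec2`; c = 2.
If `φ : F → G` is a graded minimal morphism of free modules of ranks `t` and `t+1`,
`B_t` standard determinantal and `depth_{I_{t-1}(φ)} B_t ≥ 4`, then
`0 → M → F ⊗ S₂M → G ⊗ S₂M → (S₂M ⊗ I_t(φ))(ℓ₂) → 0` is exact, the middle map being
`φ ⊗ id_{S₂M}` (the twist `ℓ₂` is invisible on underlying modules). -/
theorem statement_15 {k : Type} [Field k] [IsAlgClosed k] [CharZero k]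
    {n t : ℕ}
    (A : Matrix (Fin (t + 1)) (Fin t) (RR k n))
    (a : Fin (t + 1) → ℤ) (b : Fin t → ℤ)
    (hhom : IsHomogMatrix A a b) (hmin : IsMinMatrix A)
    (hdet : depthEQ (minors A t) (RR k n) 2)
    (hdepth : depthGE (minors A (t - 1)) (RR k n ⧸ minors A t) 4) :
    ∃ (α : (Mdl A) →ₗ[RR k n]
        ((Fin t → RR k n) ⊗[RR k n] (SymPow (RR k n) (Mdl A) 2)))
      (γ : ((Fin (t + 1) → RR k n) ⊗[RR k n] (SymPow (RR k n) (Mdl A) 2)) →ₗ[RR k n]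
        ((SymPow (RR k n) (Mdl A) 2) ⊗[RR k n] ↥(minors A t))),
      Function.Injective α ∧
      Function.Exact α
        (TensorProduct.map (phi A)
          (LinearMap.id : SymPow (RR k n) (Mdl A) 2 →ₗ[RR k n] SymPow (RR k n) (Mdl A) 2)) ∧
      Function.Exact
        (TensorProduct.map (phi A)
          (LinearMap.id : SymPow (RR k n) (Mdl A) 2 →ₗ[RR k n] SymPow (RR k n) (Mdl A) 2)) γ ∧
      Function.Surjective γ := by
  obtain _ | s := t
  · exfalso
    obtain ⟨rs, -, -, hreg⟩ := hdepth
    have : Subsingleton (RR k n ⧸ minors A 0) := by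
      rw [minors_zero]
      exact Ideal.Quotient.subsingleton_iff.2 rfl
    exact hreg.top_ne_smul (Subsingleton.elim _ _)
  rw [minors_eq_maxMinors] at hdet hdepth ⊢
  have h := injective_and_exact_of_depthGE hdet.1 hdepth
  exact ⟨coevalMul A, minorTensor A _, h.1, h.2, exact_minorTensor hdet.1 _,
    minorTensor_surjective _⟩

end KMR
end
end

section
/- Let c = 1, so φ: F → G is a graded morphism between free R-modules both of rank t, let B_t := R/I_t(φ) (a hypersurface ring, I_t(φ) generated by det φ), J := I_{t−1}(φ), M = coker(φ*), and assume depth_{I_t(φ)} R = 1 and depth_J B_t ≥ 2. Then Tor_1^R(B_t, B_t) ≅ Tor_1^R(M, S_{−1}M) as graded R-modules, where S_{−1}M := Hom_R(M, B_t); equivalently, I_t(φ)/I_t(φ)² ≅ Tor_1^R(M, Hom_R(M, B_t)). -/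
/-!
Common setup for formalizing "Schur powers of the cokernel of a graded morphism"
by J.O. Kleppe and R.M. Miró-Roig.
-/

open Matrix TensorProduct CategoryTheory

noncomputable section

namespace TwoTerm
open Limits
variable {R : Type} [CommRing R] {P₁ P₀ N : Type} [AddCommGroup P₁] [Module R P₁]
  [AddCommGroup P₀] [Module R P₀] [AddCommGroup N] [Module R N]

/-- The objects of a two-term complex concentrated in degrees `0` and `1`. -/
def obj (R P₁ P₀ : Type) [CommRing R] [AddCommGroup P₁] [Module R P₁]
    [AddCommGroup P₀] [Module R P₀] : ℕ → ModuleCat.{0} R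
  | 0 => ModuleCat.of R P₀
  | 1 => ModuleCat.of R P₁
  | _ + 2 => ModuleCat.of R PUnit

/-- The differentials of a two-term complex concentrated in degrees `0` and `1`. -/
def diff (f : P₁ →ₗ[R] P₀) : ∀ n, obj R P₁ P₀ (n + 1) ⟶ obj R P₁ P₀ n
  | 0 => ModuleCat.ofHom f
  | _ + 1 => 0

/-- The two-term complex `0 → P₁ → P₀ → 0` in degrees `1` and `0`. -/
def complex (f : P₁ →ₗ[R] P₀) : ChainComplex (ModuleCat.{0} R) ℕ :=
  ChainComplex.of (obj R P₁ P₀) (diff f) fun n => by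
    cases n <;> exact zero_comp

theorem complex_d_one_zero (f : P₁ →ₗ[R] P₀) : (complex f).d 1 0 = ModuleCat.ofHom f :=
  ChainComplex.of_d _ (diff f) 0

theorem isZero_complex_X (f : P₁ →ₗ[R] P₀) (n : ℕ) : IsZero ((complex f).X (n + 2)) :=
  ModuleCat.isZero_of_subsingleton (ModuleCat.of R PUnit)

theorem exactAt_complex (f : P₁ →ₗ[R] P₀) (hf : Function.Injective f) (n : ℕ) :
    (complex f).ExactAt (n + 1) := by
  cases n with
  | zero =>
    rw [HomologicalComplex.exactAt_iff' _ 2 1 0 (by simp) (by simp)]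
    have : Mono ((complex f).sc' 2 1 0).g := by
      change Mono ((complex f).d 1 0)
      rw [complex_d_one_zero]
      exact (ModuleCat.mono_iff_injective _).2 hf
    exact ((complex f).sc' 2 1 0).exact_iff_mono
      ((isZero_complex_X f 0).eq_of_src _ _) |>.2 this
  | succ n =>
    exact ShortComplex.exact_of_isZero_X₂ _ (isZero_complex_X f n)

theorem complex_d_comp (f : P₁ →ₗ[R] P₀) (g : P₀ →ₗ[R] N) (hfg : Function.Exact f g) :
    (complex f).d 1 0 ≫ ModuleCat.ofHom g = 0 := by
  rw [complex_d_one_zero]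
  ext x
  exact hfg.apply_apply_eq_zero x

/-- The projective resolution of the cokernel of an injective map between projective modules. -/
def resolution [Module.Projective R P₁] [Module.Projective R P₀] (f : P₁ →ₗ[R] P₀)
    (g : P₀ →ₗ[R] N) (hf : Function.Injective f) (hfg : Function.Exact f g)
    (hg : Function.Surjective g) : ProjectiveResolution (ModuleCat.of R N) where
  complex := complex f
  projective
    | 0 => (IsProjective.iff_projective P₀).1 inferInstance
    | 1 => (IsProjective.iff_projective P₁).1 inferInstance
    | n + 2 => (isZero_complex_X f n).projective
  π := (ChainComplex.toSingle₀Equiv _ _).symm ⟨ModuleCat.ofHom g, complex_d_comp f g hfg⟩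
  quasiIso := ⟨fun n => by
    cases n with
    | zero =>
      rw [ChainComplex.quasiIsoAt₀_iff, ShortComplex.quasiIso_iff_of_zeros' _ rfl rfl rfl]
      have hπ : ((ChainComplex.toSingle₀Equiv (complex f) (ModuleCat.of R N)).symm
          ⟨ModuleCat.ofHom g, complex_d_comp f g hfg⟩).f 0 = ModuleCat.ofHom g :=
        ChainComplex.toSingle₀Equiv_symm_apply_f_zero _ _
      constructor
      · rw [ShortComplex.moduleCat_exact_iff]
        intro x hx
        obtain ⟨y, hy⟩ := (hfg x).1 ((congrArg (fun h => h.hom x) hπ).symm.trans hx)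
        exact ⟨y, (congrArg (fun h => h.hom y) (complex_d_one_zero f)).trans hy⟩
      · rw [ModuleCat.epi_iff_surjective]
        intro z
        obtain ⟨x, hx⟩ := hg z
        exact ⟨x, (congrArg (fun h => h.hom x) hπ).trans hx⟩
    | succ n =>
      rw [quasiIsoAt_iff_exactAt']
      · exact exactAt_complex f hf n
      · apply ChainComplex.exactAt_succ_single_obj⟩

/-- `Tor₁(X, N)` computed from a free presentation of `N` by an injective map. -/
theorem tor_one_iso_ker [Module.Projective R P₁] [Module.Projective R P₀] (f : P₁ →ₗ[R] P₀)
    (g : P₀ →ₗ[R] N) (hf : Function.Injective f) (hfg : Function.Exact f g)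
    (hg : Function.Surjective g) (X : Type) [AddCommGroup X] [Module R X] :
    Nonempty (((Tor (ModuleCat R) 1).obj (ModuleCat.of R X)).obj (ModuleCat.of R N) ≅
      ModuleCat.of R (LinearMap.ker (f.lTensor X))) := by
  let F := (MonoidalCategory.tensoringLeft (ModuleCat.{0} R)).obj (ModuleCat.of R X)
  let K := (F.mapHomologicalComplex (ComplexShape.down ℕ)).obj (complex f)
  have e₁ : ((Tor (ModuleCat R) 1).obj (ModuleCat.of R X)).obj (ModuleCat.of R N) ≅
      K.homology 1 := (resolution f g hf hfg hg).isoLeftDerivedObj F 1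
  have e₂ : K.homology 1 ≅ (K.sc' 2 1 0).homology :=
    ShortComplex.homologyMapIso (K.isoSc' 2 1 0 (by simp) (by simp))
  have h0 : (K.sc' 2 1 0).f = 0 := (F.map_isZero (isZero_complex_X f 0)).eq_of_src _ _
  have e₃ : (K.sc' 2 1 0).homology ≅ ModuleCat.of R (LinearMap.ker (K.sc' 2 1 0).g.hom) :=
    (ShortComplex.LeftHomologyData.ofIsLimitKernelFork _ h0 _
      (ModuleCat.kernelIsLimit (K.sc' 2 1 0).g)).homologyIso
  have hd : (K.sc' 2 1 0).g = F.map (ModuleCat.ofHom f) :=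
    congrArg F.map (complex_d_one_zero f)
  exact ⟨e₁ ≪≫ e₂ ≪≫ e₃ ≪≫ eqToIso (by rw [hd]; rfl)⟩

end TwoTerm

section Adjugate

variable {ι R : Type*} [Fintype ι] [DecidableEq ι] [CommRing R]

theorem det_dvd_of_dvd_mul_adjugate (C : Matrix ι ι R) {x : R}
    (hxJ : x ∈ Ideal.span (Set.range fun ij : ι × ι => C.adjugate ij.1 ij.2))
    (hx : ∀ r, C.det ∣ x * r → C.det ∣ r) (r : R) (h : ∀ k l, C.det ∣ r * C.adjugate k l) :
    C.det ∣ r := by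
  have hJ : ∀ z ∈ Ideal.span (Set.range fun ij : ι × ι => C.adjugate ij.1 ij.2),
      C.det ∣ z * r := by
    intro z hz
    induction hz using Submodule.span_induction with
    | mem z hz =>
      obtain ⟨⟨p, q⟩, rfl⟩ := hz
      simpa [mul_comm] using h p q
    | zero => simp
    | add z w _ _ hz hw => rw [add_mul]; exact dvd_add hz hw
    | smul c z _ hz => rw [smul_eq_mul, mul_assoc]; exact hz.mul_left c
  exact hx r (hJ x hxJ)

variable [IsDomain R]

/-- The `2 × 2` minors of the adjugate are divisible by the determinant. -/
theorem det_dvd_adjugate_mul_sub (C : Matrix ι ι R) (hC : C.det ≠ 0) (p q r s : ι) :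
    C.det ∣ C.adjugate p q * C.adjugate r s - C.adjugate p s * C.adjugate r q := by
  let U : Matrix ι (Fin 2) R := Matrix.of fun i j => if i = ![q, s] j then 1 else 0
  let V : Matrix (Fin 2) ι R := Matrix.of fun j i => if i = ![p, r] j then 1 else 0
  refine ⟨(C + U * V).det - C.det - (C.adjugate p q + C.adjugate r s), ?_⟩
  obtain ⟨K, _, f, hf⟩ : ∃ (K : Type _) (_ : Field K) (f : R →+* K), Function.Injective f :=
    ⟨FractionRing R, inferInstance, algebraMap R _, IsFractionRing.injective R _⟩
  have hd : f C.det ≠ 0 := by simpa [map_eq_zero_iff f hf] using hC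
  have hdet : (C.map f).det = f C.det := (RingHom.map_det f C).symm
  have hunit : IsUnit (C.map f).det := by rw [hdet]; exact hd.isUnit
  have hadj : (C.map f).adjugate = C.adjugate.map f := (RingHom.map_adjugate f C).symm
  have hmain := det_add_mul (A := C.map f) (U.map f) (V.map f) hunit
  have hL : (C.map f + U.map f * V.map f).det = f (C + U * V).det := by
    rw [RingHom.map_det]
    congr 1
    simp [RingHom.mapMatrix_apply, Matrix.map_add, Matrix.map_mul]
  have hent : ∀ i j, (V.map f * (C.map f)⁻¹ * U.map f) i j =
      (f C.det)⁻¹ * f (C.adjugate (![p, r] i) (![q, s] j)) := by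
    intro i j
    rw [Matrix.inv_def, hdet, hadj, Ring.inverse_eq_inv']
    simp [Matrix.mul_apply, U, V, apply_ite f]
  rw [hL, hdet, det_fin_two] at hmain
  simp only [Matrix.add_apply, hent] at hmain
  apply hf
  simp only [map_sub, map_mul, map_add]
  rw [hmain]
  simp
  field_simp
  ring

theorem mem_range_mulVec_iff (C : Matrix ι ι R) (hC : C.det ≠ 0) (v : ι → R) :
    (∃ u, C *ᵥ u = v) ↔ ∀ i, C.det ∣ (C.adjugate *ᵥ v) i := by
  constructor
  · rintro ⟨u, rfl⟩ i
    rw [mulVec_mulVec, adjugate_mul, smul_mulVec, one_mulVec]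
    exact ⟨u i, rfl⟩
  · intro h
    choose u hu using h
    refine ⟨u, ?_⟩
    have h1 : C *ᵥ (C.adjugate *ᵥ v) = C.det • v := by
      rw [mulVec_mulVec, mul_adjugate, smul_mulVec, one_mulVec]
    have h2 : C.adjugate *ᵥ v = C.det • u := funext hu
    rw [h2, mulVec_smul] at h1
    exact smul_right_injective _ hC h1

/-- A matrix `W` inducing an endomorphism of the cokernel of `C` is congruent to a scalar matrix
modulo the image of `C`, as soon as the entries of the adjugate of `C` contain
(up to linear combinations) a regular sequence of length two modulo `det C`. -/
theorem exists_scalar_of_intertwines (C W V : Matrix ι ι R) (hC : C.det ≠ 0) (hW : W * C = C * V)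
    {x y : R} (hxJ : x ∈ Ideal.span (Set.range fun ij : ι × ι => C.adjugate ij.1 ij.2))
    (hyJ : y ∈ Ideal.span (Set.range fun ij : ι × ι => C.adjugate ij.1 ij.2))
    (hx : ∀ r, C.det ∣ x * r → C.det ∣ r)
    (hy : ∀ r u v, y * r = x * u + C.det * v → ∃ u v, r = x * u + C.det * v) :
    ∃ c : R, ∃ U : Matrix ι ι R, W - c • 1 = C * U := by
  set P := C.adjugate with hP
  set d := C.det with hd
  have hPW : P * W = V * P := by
    have h : d • (P * W) = d • (V * P) := by
      calc d • (P * W) = P * W * (C * P) := by rw [mul_adjugate]; simp [hd]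
        _ = P * (W * C) * P := by simp only [Matrix.mul_assoc]
        _ = (P * C) * V * P := by rw [hW]; simp only [Matrix.mul_assoc]
        _ = d • (V * P) := by rw [adjugate_mul]; simp [hd]
    exact smul_right_injective _ hC h
  have key : ∀ z ∈ Ideal.span (Set.range fun ij : ι × ι => P ij.1 ij.2),
      ∃ β, ∀ k l, d ∣ z * (P * W) k l - β * P k l := by
    intro z hz
    induction hz using Submodule.span_induction with
    | mem z hz =>
      obtain ⟨⟨p, q⟩, rfl⟩ := hz
      refine ⟨(P * W) p q, fun k l => ?_⟩
      have h1 : P p q * (P * W) k l - (V * P) k q * P p l =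
          ∑ m, V k m * (P p q * P m l - P p l * P m q) := by
        rw [hPW]
        simp only [Matrix.mul_apply, Finset.mul_sum, Finset.sum_mul, mul_sub,
          Finset.sum_sub_distrib]
        congr 1 <;> exact Finset.sum_congr rfl fun _ _ => by ring
      have h2 : (P * W) k q * P p l - (P * W) p q * P k l =
          ∑ m, W m q * (P k m * P p l - P k l * P p m) := by
        simp only [Matrix.mul_apply, Finset.sum_mul, mul_sub, Finset.sum_sub_distrib]
        congr 1 <;> exact Finset.sum_congr rfl fun _ _ => by ring
      have e : P p q * (P * W) k l - (P * W) p q * P k l =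
          (P p q * (P * W) k l - (V * P) k q * P p l) +
          ((P * W) k q * P p l - (P * W) p q * P k l) := by
        rw [hPW]; ring
      simp only
      rw [e, h1, h2]
      exact dvd_add
        (Finset.dvd_sum fun m _ => Dvd.dvd.mul_left (det_dvd_adjugate_mul_sub C hC _ _ _ _) _)
        (Finset.dvd_sum fun m _ => Dvd.dvd.mul_left (det_dvd_adjugate_mul_sub C hC _ _ _ _) _)
    | zero => exact ⟨0, by simp⟩
    | add z w _ _ hz hw =>
      obtain ⟨β, hβ⟩ := hz
      obtain ⟨γ, hγ⟩ := hw
      refine ⟨β + γ, fun k l => ?_⟩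
      convert dvd_add (hβ k l) (hγ k l) using 1
      ring
    | smul c z _ hz =>
      obtain ⟨β, hβ⟩ := hz
      refine ⟨c * β, fun k l => ?_⟩
      convert (hβ k l).mul_left c using 1
      simp only [smul_eq_mul]
      ring
  obtain ⟨β, hβ⟩ := key x hxJ
  obtain ⟨γ, hγ⟩ := key y hyJ
  obtain ⟨v, hv⟩ : d ∣ y * β - x * γ := det_dvd_of_dvd_mul_adjugate C hxJ hx _ fun k l => by
    convert dvd_sub ((hγ k l).mul_left x) ((hβ k l).mul_left y) using 1
    ring
  obtain ⟨c, e, hc⟩ := hy β γ v (by linear_combination hv)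
  have hcong : ∀ k l, d ∣ (P * (W - c • 1)) k l := fun k l => hx _ <| by
    obtain ⟨w, hw⟩ := hβ k l
    refine ⟨w + e * P k l, ?_⟩
    simp only [Matrix.mul_sub, Matrix.mul_smul, Matrix.mul_one, Matrix.sub_apply,
      Matrix.smul_apply, smul_eq_mul]
    linear_combination hw + P k l * hc
  have hcols : ∀ j, ∃ u, C *ᵥ u = (W - c • 1).col j := fun j =>
    (mem_range_mulVec_iff C hC _).2 fun i => hcong i j
  choose u hu using hcols
  refine ⟨c, Matrix.of fun i j => u j i, ?_⟩
  ext i j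
  exact (congrFun (hu j) i).symm

end Adjugate

section Tor

variable {R : Type} [CommRing R] {t : ℕ}

/-- The map `Rᵗ → Hom(coker Aᵀ, R/I)`, `v ↦ ⟨adj(A) v, -⟩`, where `det A ∈ I`. -/
def adjugatePairing (A : Matrix (Fin t) (Fin t) R) (I : Ideal R) (hI : A.det ∈ I) :
    (Fin t → R) →ₗ[R] ((Fin t → R) ⧸ LinearMap.range Aᵀ.mulVecLin) →ₗ[R] (R ⧸ I) where
  toFun v := Submodule.liftQ _ (I.mkQ ∘ₗ dotProductBilin R R (A.adjugate *ᵥ v)) (by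
    rintro _ ⟨w, rfl⟩
    rw [LinearMap.mem_ker]
    change I.mkQ ((A.adjugate *ᵥ v) ⬝ᵥ (Aᵀ *ᵥ w)) = 0
    rw [dotProduct_mulVec, vecMul_transpose, mulVec_mulVec, mul_adjugate, smul_mulVec,
      one_mulVec, smul_dotProduct, Submodule.mkQ_apply, Submodule.Quotient.mk_eq_zero]
    exact I.mul_mem_right _ hI)
  map_add' v w := by
    ext; simp [mulVec_add]
  map_smul' c v := by
    ext i
    simpa [mulVec_smul] using (Algebra.smul_def c (Ideal.Quotient.mk I ((A.adjugate *ᵥ v) i))).symm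

theorem adjugatePairing_mk (A : Matrix (Fin t) (Fin t) R) (I : Ideal R) (hI : A.det ∈ I)
    (v w : Fin t → R) :
    adjugatePairing A I hI v (Submodule.Quotient.mk w) =
      Submodule.Quotient.mk ((A.adjugate *ᵥ v) ⬝ᵥ w) :=
  rfl

theorem adjugatePairing_single (A : Matrix (Fin t) (Fin t) R) (I : Ideal R) (hI : A.det ∈ I)
    (v : Fin t → R) (i : Fin t) :
    adjugatePairing A I hI v (Submodule.Quotient.mk (Pi.single i 1)) =
      Submodule.Quotient.mk ((A.adjugate *ᵥ v) i) := by
  rw [adjugatePairing_mk, dotProduct_single_one]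

/-- The endomorphism of `Mᵗ` given by a square matrix. -/
def matrixSMul (A : Matrix (Fin t) (Fin t) R) (M : Type) [AddCommGroup M] [Module R M] :
    (Fin t → M) →ₗ[R] (Fin t → M) :=
  LinearMap.pi fun j => ∑ i, A j i • LinearMap.proj i

theorem ker_lTensor_mulVecLin (A : Matrix (Fin t) (Fin t) R) (M : Type) [AddCommGroup M]
    [Module R M] :
    Nonempty (LinearMap.ker (A.mulVecLin.lTensor M) ≃ₗ[R] LinearMap.ker (matrixSMul A M)) := by
  let q := TensorProduct.piScalarRight R R M (Fin t)
  have h : q.toLinearMap ∘ₗ A.mulVecLin.lTensor M = matrixSMul A M ∘ₗ q.toLinearMap := by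
    ext m i j
    simp [q, matrixSMul, Pi.single_apply]
  have hk : LinearMap.ker (A.mulVecLin.lTensor M) =
      (LinearMap.ker (matrixSMul A M)).comap q.toLinearMap := by
    rw [← LinearMap.ker_comp, ← h, LinearEquiv.ker_comp]
  exact ⟨(LinearEquiv.ofEq _ _ hk).trans (q.ofSubmodule' _)⟩

variable [IsDomain R]

theorem tor_one_quotient_span_singleton {I : Ideal R} {d : R} (hd : d ≠ 0)
    (hI : I = Ideal.span {d}) :
    Nonempty (((Tor (ModuleCat R) 1).obj (ModuleCat.of R (R ⧸ I))).obj (ModuleCat.of R (R ⧸ I)) ≅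
      ModuleCat.of R (R ⧸ I)) := by
  have hinj : Function.Injective (LinearMap.lsmul R R d) := smul_right_injective R hd
  have hex : Function.Exact (LinearMap.lsmul R R d) (Submodule.mkQ I) := fun x => by
    rw [Submodule.mkQ_apply, Submodule.Quotient.mk_eq_zero, hI, Ideal.mem_span_singleton]
    exact ⟨fun ⟨y, hy⟩ => ⟨y, hy.symm⟩, fun ⟨y, hy⟩ => ⟨y, hy.symm⟩⟩
  obtain ⟨e⟩ := TwoTerm.tor_one_iso_ker _ _ hinj hex (Submodule.mkQ_surjective I) (R ⧸ I)
  have hz : (LinearMap.lsmul R R d).lTensor (R ⧸ I) = 0 := by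
    ext x
    induction x using Submodule.Quotient.induction_on with
    | H x =>
      have hdI : d • (Submodule.Quotient.mk x : R ⧸ I) = 0 := by
        rw [← Submodule.Quotient.mk_smul, Submodule.Quotient.mk_eq_zero, smul_eq_mul]
        exact I.mul_mem_right _ (hI ▸ Ideal.mem_span_singleton_self d)
      simp only [LinearMap.lTensor, AlgebraTensorModule.curry_apply, curry_apply,
        LinearMap.restrictScalars_self, map_tmul, LinearMap.id_apply, LinearMap.lsmul_apply,
        LinearMap.zero_apply]
      rw [TensorProduct.tmul_smul]
      exact (TensorProduct.smul_tmul' d _ (1 : R)).trans (by rw [hdI, TensorProduct.zero_tmul])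
  refine ⟨e ≪≫ LinearEquiv.toModuleIso ?_⟩
  exact LinearEquiv.ofTop _ (by rw [hz, LinearMap.ker_zero]) ≪≫ₗ TensorProduct.rid R (R ⧸ I)

theorem cotangent_span_singleton {I : Ideal R} {d : R} (hd : d ≠ 0)
    (hI : I = Ideal.span {d}) : Nonempty (I.Cotangent ≃ₗ[R] R ⧸ I) := by
  have hdI : d ∈ I := hI ▸ Ideal.mem_span_singleton_self d
  let f : R →ₗ[R] I.Cotangent := I.toCotangent ∘ₗ LinearMap.toSpanSingleton R I ⟨d, hdI⟩
  have hker : LinearMap.ker f = I := by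
    ext r
    rw [LinearMap.mem_ker]
    change I.toCotangent (r • ⟨d, hdI⟩) = 0 ↔ _
    rw [Ideal.toCotangent_eq_zero]
    change r * d ∈ I ^ 2 ↔ _
    rw [hI, Ideal.span_singleton_pow, Ideal.mem_span_singleton, Ideal.mem_span_singleton, pow_two]
    exact mul_dvd_mul_iff_right hd
  have hsurj : Function.Surjective f := by
    intro z
    obtain ⟨⟨x, hx⟩, rfl⟩ := I.toCotangent_surjective z
    obtain ⟨r, rfl⟩ := Ideal.mem_span_singleton.1 (hI ▸ hx)
    exact ⟨r, congrArg I.toCotangent (Subtype.ext (mul_comm r d))⟩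
  exact ⟨((Submodule.quotEquivOfEq _ _ hker.symm).trans (f.quotKerEquivOfSurjective hsurj)).symm⟩

theorem exact_mulVecLin_adjugatePairing (A : Matrix (Fin t) (Fin t) R) (hA : A.det ≠ 0)
    (I : Ideal R) (hI : I = Ideal.span {A.det}) :
    Function.Exact A.mulVecLin
      (adjugatePairing A I (hI ▸ Ideal.mem_span_singleton_self A.det)) := fun v => by
  have h : v ∈ Set.range A.mulVecLin ↔ ∃ u, A *ᵥ u = v := Iff.rfl
  rw [h, mem_range_mulVec_iff A hA]
  simp only [← Ideal.mem_span_singleton, ← hI]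
  constructor
  · intro h0 i
    rw [← Submodule.Quotient.mk_eq_zero I, ← adjugatePairing_single A I
      (hI ▸ Ideal.mem_span_singleton_self A.det), h0, LinearMap.zero_apply]
  · intro hv
    ext i
    simpa [Ideal.Quotient.eq_zero_iff_mem.2 (hv i)] using
      adjugatePairing_single A I (hI ▸ Ideal.mem_span_singleton_self A.det) v i

theorem adjugatePairing_surjective (A : Matrix (Fin t) (Fin t) R) (hA : A.det ≠ 0)
    (I : Ideal R) (hI : I = Ideal.span {A.det}) :
    Function.Surjective
      (adjugatePairing A I (hI ▸ Ideal.mem_span_singleton_self A.det)) := fun h => by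
  choose v hv using fun i : Fin t =>
    Submodule.mkQ_surjective I (h (Submodule.Quotient.mk (Pi.single i 1)))
  have hAv : ∀ j, ∃ c, (A *ᵥ v) j = A.det * c := fun j => by
    rw [← dvd_def, ← Ideal.mem_span_singleton, ← hI, ← Submodule.Quotient.mk_eq_zero I]
    have h0 : (Submodule.Quotient.mk (Aᵀ *ᵥ Pi.single j 1) :
        (Fin t → R) ⧸ LinearMap.range Aᵀ.mulVecLin) = 0 :=
      (Submodule.Quotient.mk_eq_zero _).2 ⟨Pi.single j 1, rfl⟩
    have h1 : Aᵀ *ᵥ Pi.single j 1 = ∑ i, A j i • (Pi.single i 1 : Fin t → R) := by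
      ext i
      simp [Finset.sum_apply, Pi.single_apply]
    rw [h1] at h0
    have h2 := congrArg h h0
    rw [map_zero] at h2
    rw [← h2, ← Submodule.mkQ_apply, ← Submodule.mkQ_apply, mulVec, dotProduct]
    simp only [map_sum, ← smul_eq_mul, map_smul]
    exact Finset.sum_congr rfl fun i _ => by rw [hv i]; rfl
  choose u hu using hAv
  refine ⟨u, ?_⟩
  have hadj : A.adjugate *ᵥ u = v := by
    have h1 : A.adjugate *ᵥ (A *ᵥ v) = A.det • v := by
      rw [mulVec_mulVec, adjugate_mul, smul_mulVec, one_mulVec]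
    rw [show A *ᵥ v = A.det • u from funext hu, mulVec_smul] at h1
    exact smul_right_injective _ hA h1
  ext i
  simpa [hadj, ← hv i] using
    adjugatePairing_single A I (hI ▸ Ideal.mem_span_singleton_self A.det) u i

/-- The syzygies of `coker Aᵀ` over `A` are the multiples of the canonical one. -/
theorem ker_matrixSMul_coker (A : Matrix (Fin t) (Fin t) R) (hA : A.det ≠ 0)
    {I : Ideal R} (hI : I = Ideal.span {A.det})
    {x y : R} (hxJ : x ∈ Ideal.span (Set.range fun ij : Fin t × Fin t => A.adjugate ij.1 ij.2))
    (hyJ : y ∈ Ideal.span (Set.range fun ij : Fin t × Fin t => A.adjugate ij.1 ij.2))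
    (hx : ∀ r, A.det ∣ x * r → A.det ∣ r)
    (hy : ∀ r u v, y * r = x * u + A.det * v → ∃ u v, r = x * u + A.det * v) :
    Nonempty (LinearMap.ker (matrixSMul A ((Fin t → R) ⧸ LinearMap.range Aᵀ.mulVecLin))
      ≃ₗ[R] R ⧸ I) := by
  let M := (Fin t → R) ⧸ LinearMap.range Aᵀ.mulVecLin
  have hJ : Ideal.span (Set.range fun ij : Fin t × Fin t => A.adjugate ij.1 ij.2) =
      Ideal.span (Set.range fun ij : Fin t × Fin t => Aᵀ.adjugate ij.1 ij.2) := by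
    congr 1
    ext z
    simp only [Set.mem_range, Prod.exists, ← adjugate_transpose, transpose_apply]
    exact exists_comm
  have hC : Aᵀ.det ≠ 0 := by rwa [det_transpose]
  rw [hJ] at hxJ hyJ
  rw [← det_transpose] at hx hy hI
  let ψ : R →ₗ[R] (Fin t → M) :=
    LinearMap.toSpanSingleton R _ fun i => Submodule.Quotient.mk (Pi.single i 1)
  have hψ : ∀ r i, ψ r i = Submodule.Quotient.mk (r • Pi.single i 1) := fun r i => rfl
  have hmk : ∀ v : Fin t → R, (Submodule.Quotient.mk v : M) = 0 ↔ ∃ u, Aᵀ *ᵥ u = v :=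
    fun v => Submodule.Quotient.mk_eq_zero _
  have hcol : ∀ j, (∑ i, A j i • (Pi.single i 1 : Fin t → R)) = Aᵀ *ᵥ Pi.single j 1 := fun j => by
    ext i
    simp [Finset.sum_apply, Pi.single_apply]
  have hG : ∀ (w : Fin t → Fin t → R) (j : Fin t),
      matrixSMul A M (fun i => Submodule.Quotient.mk (w i)) j =
        Submodule.Quotient.mk (∑ i, A j i • w i) := fun w j => by
    rw [← Submodule.mkQ_apply, map_sum]
    simp [matrixSMul]
  have hker : LinearMap.ker ψ = I := by
    ext r
    rw [LinearMap.mem_ker, hI, Ideal.mem_span_singleton]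
    constructor
    · intro h
      refine det_dvd_of_dvd_mul_adjugate _ hxJ hx r fun k l => ?_
      have hl := (mem_range_mulVec_iff _ hC _).1 ((hmk _).1 ((hψ r l).symm.trans (congrFun h l))) k
      simpa [mulVec_smul] using hl
    · rintro ⟨c, rfl⟩
      funext i
      rw [hψ]
      refine (hmk _).2 ((mem_range_mulVec_iff _ hC _).2 fun k => ?_)
      rw [mulVec_smul, Pi.smul_apply, smul_eq_mul, mul_assoc]
      exact dvd_mul_right _ _
  have hrange : LinearMap.range ψ = LinearMap.ker (matrixSMul A M) := by
    apply le_antisymm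
    · rintro _ ⟨r, rfl⟩
      rw [LinearMap.mem_ker]
      funext j
      refine (hG (fun i => r • Pi.single i 1) j).trans ((hmk _).2 ⟨r • Pi.single j 1, ?_⟩)
      rw [mulVec_smul, ← hcol, Finset.smul_sum]
      exact Finset.sum_congr rfl fun i _ => smul_comm _ _ _
    · intro m hm
      choose w hw using fun i => Submodule.mkQ_surjective _ (m i)
      obtain rfl : (fun i => Submodule.Quotient.mk (w i)) = m := funext hw
      have hm' : ∀ j, ∃ u, Aᵀ *ᵥ u = ∑ i, A j i • w i := fun j =>
        (hmk _).1 ((hG w j).symm.trans (congrFun hm j))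
      choose u hu using hm'
      obtain ⟨c, U, hU⟩ := exists_scalar_of_intertwines Aᵀ (Matrix.of fun k i => w i k)
        (Matrix.of fun k j => u j k) hC (by
          ext k j
          refine Eq.trans ?_ (congrFun (hu j) k).symm
          simp [Matrix.mul_apply, Finset.sum_apply, mul_comm]) hxJ hyJ hx hy
      refine ⟨c, funext fun i => ?_⟩
      rw [hψ]
      refine ((Submodule.Quotient.eq (LinearMap.range Aᵀ.mulVecLin)).2 ⟨U.col i, ?_⟩).symm
      ext k
      refine (congrFun (congrFun hU k) i).symm.trans ?_
      simp [Matrix.one_apply, Pi.single_apply]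
  exact ⟨((Submodule.quotEquivOfEq _ _ hker.symm).trans
    (ψ.quotKerEquivRange.trans (LinearEquiv.ofEq _ _ hrange))).symm⟩

theorem tor_one_coker_transpose (A : Matrix (Fin t) (Fin t) R) (hA : A.det ≠ 0)
    {I : Ideal R} (hI : I = Ideal.span {A.det})
    {x y : R} (hxJ : x ∈ Ideal.span (Set.range fun ij : Fin t × Fin t => A.adjugate ij.1 ij.2))
    (hyJ : y ∈ Ideal.span (Set.range fun ij : Fin t × Fin t => A.adjugate ij.1 ij.2))
    (hx : ∀ r, A.det ∣ x * r → A.det ∣ r)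
    (hy : ∀ r u v, y * r = x * u + A.det * v → ∃ u v, r = x * u + A.det * v) :
    Nonempty (((Tor (ModuleCat R) 1).obj
        (ModuleCat.of R ((Fin t → R) ⧸ LinearMap.range Aᵀ.mulVecLin))).obj
        (ModuleCat.of R (((Fin t → R) ⧸ LinearMap.range Aᵀ.mulVecLin) →ₗ[R] R ⧸ I)) ≅
      ModuleCat.of R (R ⧸ I)) := by
  have hinj : Function.Injective A.mulVecLin :=
    (injective_iff_map_eq_zero _).2 fun _ => eq_zero_of_mulVec_eq_zero hA
  obtain ⟨e₁⟩ := TwoTerm.tor_one_iso_ker _ _ hinj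
    (exact_mulVecLin_adjugatePairing A hA I hI) (adjugatePairing_surjective A hA I hI)
    ((Fin t → R) ⧸ LinearMap.range Aᵀ.mulVecLin)
  obtain ⟨e₂⟩ := ker_lTensor_mulVecLin A ((Fin t → R) ⧸ LinearMap.range Aᵀ.mulVecLin)
  obtain ⟨e₃⟩ := ker_matrixSMul_coker A hA hI hxJ hyJ hx hy
  exact ⟨e₁ ≪≫ (e₂.trans e₃).toModuleIso⟩

end Tor

section Minors

theorem exists_regular_pair_of_depthGE_two {R : Type} [CommRing R] {J I : Ideal R} {d : R}
    (hI : I = Ideal.span {d}) (h : KMR.depthGE J (R ⧸ I) 2) :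
    ∃ x ∈ J, ∃ y ∈ J, (∀ r, d ∣ x * r → d ∣ r) ∧
      ∀ r u v, y * r = x * u + d * v → ∃ u v, r = x * u + d * v := by
  obtain ⟨rs, hlen, hmem, hreg⟩ := h
  obtain ⟨x, y, rfl⟩ := List.length_eq_two.1 hlen
  have hw := hreg.toIsWeaklyRegular
  rw [RingTheory.Sequence.isWeaklyRegular_cons_iff,
    RingTheory.Sequence.isWeaklyRegular_singleton_iff] at hw
  obtain ⟨hx, hy⟩ := hw
  have hmk : ∀ r, (Submodule.Quotient.mk r : R ⧸ I) = 0 ↔ d ∣ r := fun r => by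
    rw [Submodule.Quotient.mk_eq_zero, hI, Ideal.mem_span_singleton]
  refine ⟨x, hmem x (by simp), y, hmem y (by simp), fun r hr => ?_, fun r u v hr => ?_⟩
  · rw [← hmk] at hr ⊢
    exact hx.right_eq_zero_of_smul hr
  · have h0 : (Submodule.Quotient.mk (Submodule.Quotient.mk r : R ⧸ I) :
        QuotSMulTop x (R ⧸ I)) = 0 := by
      refine hy.right_eq_zero_of_smul ?_
      rw [← Submodule.Quotient.mk_smul, Submodule.Quotient.mk_eq_zero,
        Submodule.mem_smul_pointwise_iff_exists]
      refine ⟨Submodule.Quotient.mk u, trivial, ?_⟩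
      rw [← Submodule.Quotient.mk_smul, ← Submodule.Quotient.mk_smul, ← sub_eq_zero,
        ← Submodule.Quotient.mk_sub, hmk]
      exact ⟨-v, by simp only [smul_eq_mul]; linear_combination -hr⟩
    rw [Submodule.Quotient.mk_eq_zero, Submodule.mem_smul_pointwise_iff_exists] at h0
    obtain ⟨b, -, hb⟩ := h0
    obtain ⟨u, rfl⟩ := Submodule.mkQ_surjective I b
    rw [Submodule.mkQ_apply, ← Submodule.Quotient.mk_smul, eq_comm, ← sub_eq_zero,
      ← Submodule.Quotient.mk_sub, hmk] at hb
    obtain ⟨v, hv⟩ := hb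
    exact ⟨u, v, by rw [smul_eq_mul] at hv; linear_combination hv⟩

theorem exists_eq_succAbove_comp_perm {s : ℕ} (r : Fin s → Fin (s + 1))
    (hr : Function.Injective r) :
    ∃ (i : Fin (s + 1)) (σ : Equiv.Perm (Fin s)), r = i.succAbove ∘ σ := by
  obtain ⟨i, hi⟩ : ∃ i, ∀ j, r j ≠ i := by
    by_contra! h
    have := Fintype.card_le_of_surjective r h
    simp at this
  choose σ hσ using fun j => Fin.exists_succAbove_eq (hi j)
  have hinj : Function.Injective σ := fun a b hab => hr (by rw [← hσ a, ← hσ b, hab])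
  exact ⟨i, Equiv.ofBijective σ (Finite.injective_iff_bijective.1 hinj),
    funext fun j => (hσ j).symm⟩

theorem det_submatrix_perm_perm {s : ℕ} {R : Type*} [CommRing R] (A : Matrix (Fin s) (Fin s) R)
    (σ τ : Equiv.Perm (Fin s)) :
    (A.submatrix σ τ).det = (Equiv.Perm.sign σ * Equiv.Perm.sign τ : ℤ) * A.det := by
  have h : A.submatrix σ τ = (A.submatrix σ id).submatrix id τ := rfl
  rw [h, det_permute', det_permute]
  push_cast
  ring

variable {k : Type} [Field k] {n : ℕ}

theorem minors_self_eq_span_det {t : ℕ} (A : Matrix (Fin t) (Fin t) (KMR.RR k n)) :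
    KMR.minors A t = Ideal.span {A.det} := by
  apply le_antisymm
  · refine Ideal.span_le.2 ?_
    rintro _ ⟨r, c, hr, hc, rfl⟩
    have h := det_submatrix_perm_perm A
      (Equiv.ofBijective r (Finite.injective_iff_bijective.1 hr))
      (Equiv.ofBijective c (Finite.injective_iff_bijective.1 hc))
    exact Ideal.mem_span_singleton.2 ⟨_, h.trans (mul_comm _ _)⟩
  · refine Ideal.span_le.2 (Set.singleton_subset_iff.2 (Ideal.subset_span ?_))
    exact ⟨id, id, Function.injective_id, Function.injective_id, by simp⟩

theorem minors_pred_le_span_adjugate {s : ℕ}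
    (A : Matrix (Fin (s + 1)) (Fin (s + 1)) (KMR.RR k n)) :
    KMR.minors A s ≤
      Ideal.span (Set.range fun ij : Fin (s + 1) × Fin (s + 1) => A.adjugate ij.1 ij.2) := by
  refine Ideal.span_le.2 ?_
  rintro _ ⟨r, c, hr, hc, rfl⟩
  obtain ⟨i, σ, rfl⟩ := exists_eq_succAbove_comp_perm r hr
  obtain ⟨j, τ, rfl⟩ := exists_eq_succAbove_comp_perm c hc
  have h := det_submatrix_perm_perm (A.submatrix i.succAbove j.succAbove) σ τ
  rw [submatrix_submatrix] at h
  have hadj := adjugate_fin_succ_eq_det_submatrix A j i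
  have hdet : (A.submatrix i.succAbove j.succAbove).det =
      (-1) ^ (i + j : ℕ) * A.adjugate j i := by
    rw [hadj, ← mul_assoc, ← mul_pow]
    simp
  rw [SetLike.mem_coe, h, hdet]
  exact Ideal.mul_mem_left _ _ (Ideal.mul_mem_left _ _ (Ideal.subset_span ⟨(j, i), rfl⟩))

end Minors

namespace KMR


/-- the case `c = 1` of `conj53eq`, equation `c1n`.
Let `φ : F → G` be a graded morphism between free modules of rank `t`, so that
`I_t(φ)` is the principal ideal generated by `det φ` and `B_t = R/I_t(φ)` is a
hypersurface ring.  If `depth_{I_t(φ)} R = 1` and `depth_{I_{t-1}(φ)} B_t ≥ 2`, then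
`Tor₁^R(B_t, B_t) ≅ Tor₁^R(M, S₋₁M)` where `S₋₁M = Hom_R(M, B_t)`; equivalently,
`I_t(φ)/I_t(φ)² ≅ Tor₁^R(M, Hom_R(M, B_t))`. -/
theorem statement_19 {k : Type} [Field k] [IsAlgClosed k] [CharZero k]
    {n t : ℕ}
    (A : Matrix (Fin t) (Fin t) (RR k n))
    (a : Fin t → ℤ) (b : Fin t → ℤ)
    (hhom : IsHomogMatrix A a b)
    (hdet : depthEQ (minors A t) (RR k n) 1)
    (hdepth : depthGE (minors A (t - 1)) (RR k n ⧸ minors A t) 2) :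
    misoM (TorM (RR k n) 1 (RR k n ⧸ minors A t) (RR k n ⧸ minors A t))
      (TorM (RR k n) 1 (Mdl A) (SymZ A (-1))) ∧
    misoM (ModuleCat.of (RR k n) (Ideal.Cotangent (minors A t)))
      (TorM (RR k n) 1 (Mdl A) (SymZ A (-1))) := by
  have hI := minors_self_eq_span_det A
  have hA : A.det ≠ 0 := by
    intro h0
    obtain ⟨rs, hlen, hmem, hreg⟩ := hdet.1
    obtain ⟨x, rfl⟩ := List.length_eq_one_iff.1 hlen
    have hx : x = 0 := by simpa [hI, h0] using hmem x (by simp)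
    have hr := (RingTheory.Sequence.isWeaklyRegular_singleton_iff _ x).1 hreg.toIsWeaklyRegular
    exact one_ne_zero (hr.right_eq_zero_of_smul (x := (1 : RR k n)) (by simp [hx]))
  obtain ⟨x, hxJ, y, hyJ, hx, hy⟩ := exists_regular_pair_of_depthGE_two hI hdepth
  have hJ : minors A (t - 1) ≤
      Ideal.span (Set.range fun ij : Fin t × Fin t => A.adjugate ij.1 ij.2) := by
    cases t with
    | zero =>
      obtain ⟨rs, -, -, hreg⟩ := hdepth
      have := hreg.nontrivial
      refine absurd ?_ (Ideal.Quotient.nontrivial_iff.1 this)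
      rw [hI, det_fin_zero, Ideal.span_singleton_one]
    | succ s => exact minors_pred_le_span_adjugate A
  have hS : TorM (RR k n) 1 (Mdl A) (SymZ A (-1)) =
      TorM (RR k n) 1 (Mdl A) (Mdl A →ₗ[RR k n] (RR k n ⧸ minors A t)) := rfl
  obtain ⟨e⟩ : Nonempty (TorM (RR k n) 1 (Mdl A) (Mdl A →ₗ[RR k n] (RR k n ⧸ minors A t)) ≅
      ModuleCat.of (RR k n) (RR k n ⧸ minors A t)) :=
    tor_one_coker_transpose A hA hI (hJ hxJ) (hJ hyJ) hx hy
  obtain ⟨e₁⟩ := tor_one_quotient_span_singleton hA hI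
  obtain ⟨e₂⟩ := cotangent_span_singleton hA hI
  rw [hS]
  exact ⟨⟨e₁ ≪≫ e.symm⟩, ⟨e₂.toModuleIso ≪≫ e.symm⟩⟩

end KMR
end
end
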